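/- arXiv:2501.12373 — 6 statements merged into one kernel-verified Lean document; each statement's English description precedes it below -/
import Mathlib

section
/- Fix an integer d ≥ 1. There exists a constant C = C(d) > 0 such that for every t ∈ (0,1], the d-dimensional Lebesgue measure of the set Λ = {x ∈ (−1,1)^d : ∏_{k=1}^d |x_k| ≤ t} is at most C · t · (1 + log(1/t))^{d−1}. -/
open MeasureTheory

/-- The points of the open cube `(-1, 1)^d` whose coordinates have product at most `t` in
absolute value. -/
def hyperbolicCross (d : ℕ) (t : ℝ) : Set (Fin d → ℝ) :=
  {x | (∀ k, x k ∈ Set.Ioo (-1 : ℝ) 1) ∧ ∏ k, |x k| ≤ t}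

lemma measurableSet_hyperbolicCross (d : ℕ) (t : ℝ) :
    MeasurableSet (hyperbolicCross d t) := by
  have h₁ : MeasurableSet {x : Fin d → ℝ | ∀ k, x k ∈ Set.Ioo (-1 : ℝ) 1} := by
    rw [Set.ofPred_forall]
    exact MeasurableSet.iInter fun k => measurable_pi_apply k measurableSet_Ioo
  have h₂ : MeasurableSet {x : Fin d → ℝ | ∏ k, |x k| ≤ t} :=
    (isClosed_le (by fun_prop) continuous_const).measurableSet
  exact h₁.inter h₂

lemma volume_hyperbolicCross_le_two_pow (d : ℕ) (t : ℝ) :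
    volume (hyperbolicCross d t) ≤ ENNReal.ofReal (2 ^ d) := by
  calc volume (hyperbolicCross d t)
      ≤ volume (Set.Icc (fun _ : Fin d => (-1 : ℝ)) (fun _ => 1)) :=
        measure_mono fun x hx => ⟨fun k => (hx.1 k).1.le, fun k => (hx.1 k).2.le⟩
    _ = ENNReal.ofReal (2 ^ d) := by
        rw [Real.volume_Icc_pi, ← ENNReal.ofReal_prod_of_nonneg (by intros; norm_num)]
        norm_num

lemma volume_hyperbolicCross_succ (d : ℕ) (t : ℝ) :
    volume (hyperbolicCross (d + 1) t) =
      ∫⁻ y : ℝ, volume {z : Fin d → ℝ | Fin.cons y z ∈ hyperbolicCross (d + 1) t} := by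
  have hm := (volume_preserving_piFinSuccAbove (fun _ : Fin (d + 1) => ℝ) 0).symm
  rw [← hm.measure_preimage (measurableSet_hyperbolicCross _ _).nullMeasurableSet,
    Measure.volume_eq_prod,
    Measure.prod_apply (hm.measurable (measurableSet_hyperbolicCross _ _))]
  refine lintegral_congr fun y => congrArg _ ?_
  ext z
  simp [MeasurableEquiv.piFinSuccAbove, Fin.insertNthEquiv]

lemma cons_mem_hyperbolicCross {d : ℕ} {t y : ℝ} {z : Fin d → ℝ} :
    (Fin.cons y z : Fin (d + 1) → ℝ) ∈ hyperbolicCross (d + 1) t ↔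
      y ∈ Set.Ioo (-1 : ℝ) 1 ∧ (∀ k, z k ∈ Set.Ioo (-1 : ℝ) 1) ∧ |y| * ∏ k, |z k| ≤ t := by
  simp only [hyperbolicCross, Set.mem_ofPred_eq, Fin.forall_fin_succ, Fin.prod_univ_succ,
    Fin.cons_zero, Fin.cons_succ, and_assoc]

lemma lintegral_ofReal_mul_inv_Ioc {c t : ℝ} (hc : 0 ≤ c) (ht : 0 < t) (ht1 : t ≤ 1) :
    ∫⁻ y in Set.Ioc t 1, ENNReal.ofReal (c * |y|⁻¹) = ENNReal.ofReal (c * Real.log (1 / t)) := by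
  have hint : IntervalIntegrable (fun y : ℝ => c * y⁻¹) volume t 1 := by
    refine (intervalIntegral.intervalIntegrable_inv (fun x hx => ?_) continuousOn_id).const_mul c
    rw [Set.uIcc_of_le ht1] at hx
    exact (ht.trans_le hx.1).ne'
  rw [intervalIntegrable_iff_integrableOn_Ioc_of_le ht1] at hint
  rw [← integral_inv_of_pos ht one_pos, ← intervalIntegral.integral_const_mul,
    intervalIntegral.integral_of_le ht1, ofReal_integral_eq_lintegral_ofReal hint]
  · refine setLIntegral_congr_fun measurableSet_Ioc fun y hy => ?_
    simp only [abs_of_pos (ht.trans hy.1)]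
  · refine (ae_restrict_iff' measurableSet_Ioc).2 (ae_of_all _ fun y hy => ?_)
    exact mul_nonneg hc (inv_nonneg.2 (ht.trans hy.1).le)

lemma lintegral_ofReal_mul_inv_Ico {c t : ℝ} (hc : 0 ≤ c) (ht : 0 < t) (ht1 : t ≤ 1) :
    ∫⁻ y in Set.Ico (-1) (-t), ENNReal.ofReal (c * |y|⁻¹) =
      ENNReal.ofReal (c * Real.log (1 / t)) := by
  rw [← lintegral_ofReal_mul_inv_Ioc hc ht ht1,
    ← (Measure.measurePreserving_neg (volume : Measure ℝ)).setLIntegral_comp_preimage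
      measurableSet_Ioc (by fun_prop)]
  simp

theorem volume_hyperbolicCross_succ_le (n : ℕ) {t : ℝ} (ht : 0 < t) (ht1 : t ≤ 1) :
    volume (hyperbolicCross (n + 1) t) ≤
      ENNReal.ofReal (2 ^ (n + 1) * t * (1 + Real.log (1 / t)) ^ n) := by
  induction n generalizing t with
  | zero =>
    calc volume (hyperbolicCross 1 t)
        ≤ volume (Set.Icc (fun _ : Fin 1 => -t) (fun _ => t)) := by
          refine measure_mono fun x hx => ?_
          have h : |x 0| ≤ t := by simpa using hx.2
          rw [abs_le] at h
          constructor <;> intro k <;> rw [Subsingleton.elim k 0]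
          exacts [h.1, h.2]
      _ ≤ _ := by
          rw [Real.volume_Icc_pi]
          simp [two_mul]
  | succ n ih =>
    set l := Real.log (1 / t)
    have hl0 : 0 ≤ l := Real.log_nonneg (by rw [le_div_iff₀ ht]; linarith)
    set c : ℝ := 2 ^ (n + 1) * t * (1 + l) ^ n with hc
    have hc0 : 0 ≤ c := by positivity
    let S : ℝ → Set (Fin (n + 1) → ℝ) :=
      fun y => {z | (Fin.cons y z : Fin (n + 2) → ℝ) ∈ hyperbolicCross (n + 2) t}
    have hcube (y : ℝ) : volume (S y) ≤ ENNReal.ofReal (2 ^ (n + 1)) := by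
      refine (measure_mono fun z hz => ?_).trans (volume_hyperbolicCross_le_two_pow (n + 1) 1)
      have hz := (cons_mem_hyperbolicCross.1 hz).2.1
      refine ⟨hz, Finset.prod_le_one (fun _ _ => abs_nonneg _) fun k _ => ?_⟩
      exact abs_le.2 ⟨(hz k).1.le, (hz k).2.le⟩
    have hslice (y : ℝ) (hy : t < |y|) (hy1 : |y| ≤ 1) :
        volume (S y) ≤ ENNReal.ofReal (c * |y|⁻¹) := by
      have hy0 : 0 < |y| := ht.trans hy
      have hpos : 0 < t / |y| := div_pos ht hy0
      have hle : t / |y| ≤ 1 := (div_le_one hy0).2 hy.le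
      have hlog0 : 0 ≤ Real.log (1 / (t / |y|)) :=
        Real.log_nonneg (by rw [le_div_iff₀ hpos]; linarith)
      have hlog : Real.log (1 / (t / |y|)) ≤ l := by
        refine Real.log_le_log (by positivity) (one_div_le_one_div_of_le ht ?_)
        rw [le_div_iff₀ hy0]
        nlinarith
      calc volume (S y) ≤ volume (hyperbolicCross (n + 1) (t / |y|)) := by
            refine measure_mono fun z hz => ?_
            have hz := (cons_mem_hyperbolicCross.1 hz).2
            refine ⟨hz.1, ?_⟩
            rw [le_div_iff₀ hy0, mul_comm]
            exact hz.2
        _ ≤ _ := ih hpos hle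
        _ ≤ ENNReal.ofReal (2 ^ (n + 1) * (t / |y|) * (1 + l) ^ n) := by gcongr
        _ = _ := by rw [hc]; congr 1; ring
    have hsupp : Function.support (fun y => volume (S y)) ⊆
        Set.Icc (-t) t ∪ (Set.Ioc t 1 ∪ Set.Ico (-1) (-t)) := by
      intro y hy
      have hne : (S y).Nonempty := nonempty_of_measure_ne_zero hy
      obtain ⟨z, hz⟩ := hne
      have hy1 := (cons_mem_hyperbolicCross.1 hz).1
      rcases lt_or_ge t y with h | h
      · exact Or.inr (Or.inl ⟨h, hy1.2.le⟩)
      rcases lt_or_ge y (-t) with h' | h'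
      · exact Or.inr (Or.inr ⟨hy1.1.le, h'⟩)
      · exact Or.inl ⟨h', h⟩
    have hone : 1 ≤ (1 + l) ^ n := one_le_pow₀ (by linarith)
    calc volume (hyperbolicCross (n + 2) t) = ∫⁻ y, volume (S y) :=
          volume_hyperbolicCross_succ _ _
      _ = ∫⁻ y in Set.Icc (-t) t ∪ (Set.Ioc t 1 ∪ Set.Ico (-1) (-t)), volume (S y) :=
          (setLIntegral_eq_of_support_subset hsupp).symm
      _ ≤ (∫⁻ y in Set.Icc (-t) t, volume (S y)) +
          ((∫⁻ y in Set.Ioc t 1, volume (S y)) + ∫⁻ y in Set.Ico (-1) (-t), volume (S y)) :=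
          (lintegral_union_le _ _ _).trans (by gcongr; exact lintegral_union_le _ _ _)
      _ ≤ (∫⁻ _ in Set.Icc (-t) t, ENNReal.ofReal (2 ^ (n + 1))) +
          ((∫⁻ y in Set.Ioc t 1, ENNReal.ofReal (c * |y|⁻¹)) +
            ∫⁻ y in Set.Ico (-1) (-t), ENNReal.ofReal (c * |y|⁻¹)) := by
          refine add_le_add (lintegral_mono fun y => hcube y) (add_le_add ?_ ?_)
          · refine setLIntegral_mono' measurableSet_Ioc fun y hy => ?_
            have h := abs_of_pos (ht.trans hy.1)
            exact hslice y (by rw [h]; exact hy.1) (by rw [h]; exact hy.2)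
          · refine setLIntegral_mono' measurableSet_Ico fun y hy => ?_
            have h := abs_of_neg (hy.2.trans (neg_lt_zero.2 ht))
            exact hslice y (by rw [h]; linarith [hy.2]) (by rw [h]; linarith [hy.1])
      _ = ENNReal.ofReal (2 ^ (n + 1) * (t - -t) + (c * l + c * l)) := by
          rw [lintegral_ofReal_mul_inv_Ioc hc0 ht ht1, lintegral_ofReal_mul_inv_Ico hc0 ht ht1,
            setLIntegral_const, Real.volume_Icc, ← ENNReal.ofReal_mul (by positivity),
            ← ENNReal.ofReal_add (by positivity) (by positivity),
            ← ENNReal.ofReal_add (mul_nonneg (by positivity) (by linarith)) (by positivity)]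
      _ ≤ _ := by
          refine ENNReal.ofReal_le_ofReal ?_
          have h : 2 ^ (n + 2) * t * 1 ≤ 2 ^ (n + 2) * t * (1 + l) ^ n := by gcongr
          rw [hc]
          calc _ = 2 ^ (n + 2) * t * 1 + 2 ^ (n + 2) * t * (1 + l) ^ n * l := by ring
            _ ≤ 2 ^ (n + 2) * t * (1 + l) ^ n + 2 ^ (n + 2) * t * (1 + l) ^ n * l := by gcongr
            _ = _ := by ring

theorem stmt_8 (d : ℕ) (hd : 1 ≤ d) :
    ∃ C : ℝ, 0 < C ∧ ∀ t : ℝ, 0 < t → t ≤ 1 →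
      volume {x : Fin d → ℝ | (∀ k, x k ∈ Set.Ioo (-1 : ℝ) 1) ∧ ∏ k, |x k| ≤ t}
        ≤ ENNReal.ofReal (C * t * (1 + Real.log (1 / t)) ^ (d - 1)) := by
  obtain ⟨n, rfl⟩ := Nat.exists_eq_add_of_le' hd
  exact ⟨2 ^ (n + 1), by positivity, fun t ht ht1 => volume_hyperbolicCross_succ_le n ht ht1⟩
end

section
/- There exists an absolute constant C > 0 such that the following holds for every d = 2 point configuration: for every finite set P ⊆ ℝ² in which all points have pairwise distinct first coordinates and pairwise distinct second coordinates, and for every p ∈ P, the number of edges of the box-Delaunay graph of P having both endpoints in the neighbourhood N(p) of p is at most C · deg(p), where deg(p) = |N(p)| is the degree of p in the box-Delaunay graph. -/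
/-- The open axis-parallel box `R[x,y]` with opposite corners `x` and `y`. -/
def openBox (x y : Fin 2 → ℝ) : Set (Fin 2 → ℝ) :=
  {z | ∀ k, min (x k) (y k) < z k ∧ z k < max (x k) (y k)}

/-- Adjacency in the box-Delaunay graph of the finite point set `P ⊆ ℝ²`:
distinct points `x, y ∈ P` are adjacent iff the open box `R[x,y]` contains
no point of `P`. -/
def adjP (P : Finset (Fin 2 → ℝ)) (x y : Fin 2 → ℝ) : Prop :=
  x ∈ P ∧ y ∈ P ∧ x ≠ y ∧ ∀ z ∈ P, z ∉ openBox x y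

/-- `b` lies strictly between `a` and `c`, in either order. -/
def StrictBetween (a b c : ℝ) : Prop :=
  (a < b ∧ b < c) ∨ (c < b ∧ b < a)

theorem min_lt_and_lt_max_iff (a b c : ℝ) :
    (min a c < b ∧ b < max a c) ↔ StrictBetween a b c := by
  unfold StrictBetween
  rw [min_lt_iff, lt_max_iff]
  grind

theorem mem_openBox_iff (k : Fin 2) (x y z : Fin 2 → ℝ) :
    z ∈ openBox x y ↔
      StrictBetween (x k) (z k) (y k) ∧ StrictBetween (x (1 - k)) (z (1 - k)) (y (1 - k)) := by
  simp only [openBox, Set.mem_ofPred_eq, min_lt_and_lt_max_iff, Fin.forall_fin_two]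
  fin_cases k
  · simp
  · simp [and_comm]

theorem openBox_comm (x y : Fin 2 → ℝ) : openBox x y = openBox y x := by
  simp only [openBox, min_comm, max_comm]

theorem adjP.symm {P : Finset (Fin 2 → ℝ)} {x y : Fin 2 → ℝ} (h : adjP P x y) : adjP P y x :=
  ⟨h.2.1, h.1, h.2.2.1.symm, fun z hz => openBox_comm x y ▸ h.2.2.2 z hz⟩

/-- `u` and `v` are adjacent neighbours of `p` on the same side of `p` in coordinate `k`, with `u`
closer to `p` there; `b` records the side of `u` in the other coordinate. -/
def IsInnerNeighbour (P : Finset (Fin 2 → ℝ)) (p v : Fin 2 → ℝ) (k : Fin 2) (b : Bool)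
    (u : Fin 2 → ℝ) : Prop :=
  adjP P p u ∧ adjP P p v ∧ adjP P u v ∧ StrictBetween (p k) (u k) (v k) ∧
    (b = true ↔ p (1 - k) < u (1 - k))

theorem IsInnerNeighbour.not_strictBetween {P : Finset (Fin 2 → ℝ)}
    (hP : ∀ x ∈ P, ∀ y ∈ P, ∀ k, x k = y k → x = y) {p v u w : Fin 2 → ℝ} {k : Fin 2} {b : Bool}
    (hu : IsInnerNeighbour P p v k b u) (hw : IsInnerNeighbour P p v k b w) :
    ¬ StrictBetween (p k) (u k) (w k) := by
  intro h
  obtain ⟨⟨hpP, huP, hpu, -⟩, ⟨-, hvP, -, hv⟩, ⟨-, -, -, huv⟩, hb, hs⟩ := hu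
  obtain ⟨⟨-, hwP, hpw, hw⟩, -, ⟨-, -, hwv, -⟩, hb', hs'⟩ := hw
  have huw : u ≠ w := by
    rintro rfl
    exact h.elim (fun h => lt_irrefl _ h.2) (fun h => lt_irrefl _ h.1)
  have e1 := mt (hP p hpP u huP (1 - k)) hpu
  have e2 := mt (hP p hpP w hwP (1 - k)) hpw
  have e3 := mt (hP u huP w hwP (1 - k)) huw
  have e4 := mt (hP w hwP v hvP (1 - k)) hwv
  have h1 := hw u huP
  have h2 := hv w hwP
  have h3 := huv w hwP
  rw [mem_openBox_iff k] at h1 h2 h3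
  have hs : p (1 - k) < u (1 - k) ↔ p (1 - k) < w (1 - k) := hs.symm.trans hs'
  unfold StrictBetween at *
  generalize p (1 - k) = pj at *
  generalize u (1 - k) = uj at *
  generalize v (1 - k) = vj at *
  generalize w (1 - k) = wj at *
  grind

theorem IsInnerNeighbour.unique {P : Finset (Fin 2 → ℝ)}
    (hP : ∀ x ∈ P, ∀ y ∈ P, ∀ k, x k = y k → x = y) {p v u w : Fin 2 → ℝ} {k : Fin 2} {b : Bool}
    (hu : IsInnerNeighbour P p v k b u) (hw : IsInnerNeighbour P p v k b w) : u = w := by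
  have h1 := hu.not_strictBetween hP hw
  have h2 := hw.not_strictBetween hP hu
  refine hP u hu.1.2.1 w hw.1.2.1 k ?_
  have h3 := hu.2.2.2.1
  have h4 := hw.2.2.2.1
  unfold StrictBetween at *
  grind

theorem exists_isInnerNeighbour {P : Finset (Fin 2 → ℝ)}
    (hP : ∀ x ∈ P, ∀ y ∈ P, ∀ k, x k = y k → x = y) {p u v : Fin 2 → ℝ}
    (hu : adjP P p u) (hv : adjP P p v) (huv : adjP P u v) :
    ∃ k b, IsInnerNeighbour P p v k b u ∨ IsInnerNeighbour P p u k b v := by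
  have hp := huv.2.2.2 p hu.1
  simp only [openBox, Set.mem_ofPred_eq, min_lt_and_lt_max_iff, not_forall] at hp
  obtain ⟨k, hk⟩ := hp
  have e1 := mt (hP p hu.1 u hu.2.1 k) hu.2.2.1
  have e2 := mt (hP p hu.1 v hv.2.1 k) hv.2.2.1
  have e3 := mt (hP u hu.2.1 v hv.2.1 k) huv.2.2.1
  have h : StrictBetween (p k) (u k) (v k) ∨ StrictBetween (p k) (v k) (u k) := by
    unfold StrictBetween at *
    grind
  rcases h with h | h
  · exact ⟨k, decide (p (1 - k) < u (1 - k)), Or.inl ⟨hu, hv, huv, h, decide_eq_true_iff⟩⟩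
  · exact ⟨k, decide (p (1 - k) < v (1 - k)), Or.inr ⟨hv, hu, huv.symm, h, decide_eq_true_iff⟩⟩

theorem stmt_9 :
    ∃ C : ℝ, 0 < C ∧
      ∀ P : Finset (Fin 2 → ℝ),
        (∀ x ∈ P, ∀ y ∈ P, ∀ k, x k = y k → x = y) →
        ∀ p ∈ P,
          (({q : Sym2 (Fin 2 → ℝ) | ∃ u v, q = s(u, v) ∧
              adjP P p u ∧ adjP P p v ∧ adjP P u v}).ncard : ℝ)
            ≤ C * (({y : Fin 2 → ℝ | adjP P p y}).ncard : ℝ) := by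
  classical
  refine ⟨4, by norm_num, fun P hP p _ => ?_⟩
  set N : Set (Fin 2 → ℝ) := {y | adjP P p y} with hN
  have hfin : N.Finite := P.finite_toSet.subset fun y hy => hy.2.1
  let T : Finset ((Fin 2 → ℝ) × Fin 2 × Bool) := hfin.toFinset ×ˢ Finset.univ
  let g : (Fin 2 → ℝ) × Fin 2 × Bool → Sym2 (Fin 2 → ℝ) := fun t =>
    s(Classical.epsilon (IsInnerNeighbour P p t.1 t.2.1 t.2.2), t.1)
  have hg : ∀ u v k b, IsInnerNeighbour P p v k b u → s(u, v) ∈ T.image g := by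
    intro u v k b h
    refine Finset.mem_image.2 ⟨(v, k, b), ?_, ?_⟩
    · exact Finset.mem_product.2 ⟨hfin.mem_toFinset.2 h.2.1, Finset.mem_univ _⟩
    · have := (Classical.epsilon_spec (p := IsInnerNeighbour P p v k b) ⟨u, h⟩).unique hP h
      simp only [g, this]
  have hsub : {q : Sym2 (Fin 2 → ℝ) | ∃ u v, q = s(u, v) ∧
      adjP P p u ∧ adjP P p v ∧ adjP P u v} ⊆ (T.image g : Finset _) := by
    rintro q ⟨u, v, rfl, hu, hv, huv⟩
    obtain ⟨k, b, h | h⟩ := exists_isInnerNeighbour hP hu hv huv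
    · exact hg u v k b h
    · rw [Sym2.eq_swap]
      exact hg v u k b h
  have hT : T.card = 4 * N.ncard := by
    rw [Finset.card_product, ← Set.ncard_eq_toFinset_card N hfin, mul_comm]
    rfl
  have hle := Set.ncard_le_ncard hsub (T.image g).finite_toSet
  rw [Set.ncard_coe_finset] at hle
  exact_mod_cast hle.trans (Finset.card_image_le.trans hT.le)
end

section
/- Fix an integer d ≥ 3. There exists a constant C = C(d) > 0 such that for every ζ ∈ (0, 1/2) and every x ∈ (−1,1)^d with all coordinates nonzero and ∏_{k=1}^d |x_k| ≤ ζ, the d-dimensional Lebesgue measure of the set { y ∈ (−1,1)^d : ∏_{k=1}^d |y_k| ≤ ∏_{k=1}^d |x_k| and ∏_{k=1}^d |x_k − y_k| ≤ ζ } is at most C · ζ · (log(1/ζ))^{d−2}. -/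
open MeasureTheory
open scoped ENNReal

/-- Tonelli's theorem for a product of functions of the individual coordinates. -/
theorem lintegral_fin_prod_volume {n : ℕ} (f : Fin n → ℝ → ℝ≥0∞) (hf : ∀ i, Measurable (f i)) :
    ∫⁻ y : Fin n → ℝ, ∏ i, f i (y i) = ∏ i, ∫⁻ t, f i t := by
  induction n with
  | zero => simp [volume_pi]
  | succ n ih =>
    have e := (volume_preserving_piFinSuccAbove (fun _ : Fin (n + 1) => ℝ) 0).symm
    rw [← e.lintegral_comp_emb (MeasurableEquiv.measurableEmbedding _)]
    simp_rw [MeasurableEquiv.piFinSuccAbove_symm_apply, Fin.insertNthEquiv,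
      Fin.prod_univ_succ, Fin.insertNth_zero, Equiv.coe_fn_mk, Fin.cons_succ, Fin.cons_zero]
    rw [← ih (fun i => f i.succ) (fun i => hf _)]
    exact lintegral_prod_mul (hf 0).aemeasurable
      (Finset.measurable_fun_prod _ fun (i : Fin n) _ =>
        (hf i.succ).comp (measurable_pi_apply i)).aemeasurable

/-- A majorant of `a ^ (-3/4) * b ^ (-3/4)` when `a ≤ b` and `1 ≤ a + b`. -/
noncomputable def rpowMajorant (a : ℝ≥0∞) : ℝ≥0∞ :=
  if a < 1 then 2 * a ^ (-(3 / 4) : ℝ) else a ^ (-(3 / 2) : ℝ)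

theorem measurable_rpowMajorant : Measurable rpowMajorant :=
  Measurable.ite measurableSet_Iio (by fun_prop) (by fun_prop)

theorem ENNReal.rpow_neg_le_rpow_neg {a b : ℝ≥0∞} {r : ℝ} (h : a ≤ b) (hr : 0 ≤ r) :
    b ^ (-r) ≤ a ^ (-r) := by
  rw [ENNReal.rpow_neg, ENNReal.rpow_neg, ENNReal.inv_le_inv]
  exact ENNReal.rpow_le_rpow h hr

theorem rpow_mul_rpow_le_rpowMajorant {a b : ℝ≥0∞} (ha : a ≠ ⊤) (hab : a ≤ b)
    (h1 : 1 ≤ a + b) :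
    a ^ (-(3 / 4) : ℝ) * b ^ (-(3 / 4) : ℝ) ≤ rpowMajorant a := by
  unfold rpowMajorant
  split_ifs with h
  · rw [mul_comm]
    gcongr
    have hb : (2 : ℝ≥0∞)⁻¹ ≤ b := by
      by_contra! hb
      have h2 : a + b < 2⁻¹ + 2⁻¹ := ENNReal.add_lt_add (hab.trans_lt hb) hb
      rw [ENNReal.inv_two_add_inv_two] at h2
      exact absurd h1 h2.not_ge
    calc b ^ (-(3 / 4) : ℝ) ≤ (2 : ℝ≥0∞)⁻¹ ^ (-(3 / 4) : ℝ) :=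
          ENNReal.rpow_neg_le_rpow_neg hb (by norm_num)
      _ = 2 ^ (3 / 4 : ℝ) := by rw [ENNReal.inv_rpow, ENNReal.rpow_neg, inv_inv]
      _ ≤ 2 ^ (1 : ℝ) := ENNReal.rpow_le_rpow_of_exponent_le (by norm_num) (by norm_num)
      _ = 2 := ENNReal.rpow_one _
  · have ha0 : a ≠ 0 := by rintro rfl; simp at h
    calc a ^ (-(3 / 4) : ℝ) * b ^ (-(3 / 4) : ℝ)
        ≤ a ^ (-(3 / 4) : ℝ) * a ^ (-(3 / 4) : ℝ) := by
          exact mul_le_mul' le_rfl (ENNReal.rpow_neg_le_rpow_neg hab (by norm_num))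
      _ = a ^ (-(3 / 2) : ℝ) := by
          rw [← ENNReal.rpow_add _ _ ha0 ha]; norm_num

theorem lintegral_rpowMajorant_enorm_lt_top : ∫⁻ t : ℝ, rpowMajorant ‖t‖ₑ < ⊤ := by
  let H : ℝ → ℝ := fun s => if s < 1 then 2 * s ^ (-(3 / 4) : ℝ) else s ^ (-(3 / 2) : ℝ)
  have hI : IntegrableOn H (Set.Ioi 0) := by
    rw [← Set.Ioo_union_Ici_eq_Ioi (zero_lt_one' ℝ), integrableOn_union]
    constructor
    · refine IntegrableOn.congr_fun (f := fun s : ℝ => 2 * s ^ (-(3 / 4) : ℝ)) ?_ ?_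
        measurableSet_Ioo
      · exact Integrable.const_mul
          ((intervalIntegral.integrableOn_Ioo_rpow_iff zero_lt_one).2 (by norm_num)) _
      · intro s hs
        simp [H, hs.2]
    · refine IntegrableOn.congr_fun (f := fun s : ℝ => s ^ (-(3 / 2) : ℝ)) ?_ ?_
        measurableSet_Ici
      · rw [integrableOn_Ici_iff_integrableOn_Ioi]
        exact integrableOn_Ioi_rpow_of_lt (by norm_num) zero_lt_one
      · intro s hs
        simp [H, not_lt.2 (Set.mem_Ici.1 hs)]
  have hJ : Integrable (fun t : ℝ => H ‖t‖) := by
    rw [integrable_fun_norm_addHaar]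
    simpa using hI
  refine lt_of_le_of_lt (lintegral_mono_ae ?_) hJ.2
  filter_upwards [Measure.ae_ne volume (0 : ℝ)] with t ht
  have hp : 0 < ‖t‖ := norm_pos_iff.2 ht
  have hn : ‖t‖ₑ = ENNReal.ofReal ‖t‖ := (ofReal_norm t).symm
  have hH : 0 ≤ H ‖t‖ := by dsimp only [H]; split_ifs <;> positivity
  rw [Real.enorm_of_nonneg hH, hn]
  unfold rpowMajorant
  simp only [H, ENNReal.ofReal_lt_one]
  split_ifs
  · rw [ENNReal.ofReal_mul zero_le_two, ENNReal.ofReal_rpow_of_pos hp]; simp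
  · rw [ENNReal.ofReal_rpow_of_pos hp]

theorem lintegral_rpow_mul_rpow_one_sub_lt_top :
    ∫⁻ t : ℝ, ‖t‖ₑ ^ (-(3 / 4) : ℝ) * ‖1 - t‖ₑ ^ (-(3 / 4) : ℝ) < ⊤ := by
  have hm : Measurable fun t : ℝ => rpowMajorant ‖t‖ₑ :=
    measurable_rpowMajorant.comp measurable_enorm
  have hsum : ∫⁻ t : ℝ, (rpowMajorant ‖t‖ₑ + rpowMajorant ‖1 - t‖ₑ) < ⊤ := by
    rw [lintegral_add_left hm, lintegral_sub_left_eq_self (fun t : ℝ => rpowMajorant ‖t‖ₑ)]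
    exact ENNReal.add_lt_top.2
      ⟨lintegral_rpowMajorant_enorm_lt_top, lintegral_rpowMajorant_enorm_lt_top⟩
  refine lt_of_le_of_lt (lintegral_mono fun t => ?_) hsum
  have h1 : 1 ≤ ‖t‖ₑ + ‖1 - t‖ₑ := by
    simpa using enorm_add_le t (1 - t)
  rcases le_total ‖t‖ₑ ‖1 - t‖ₑ with h | h
  · exact (rpow_mul_rpow_le_rpowMajorant enorm_ne_top h h1).trans le_self_add
  · rw [mul_comm]
    exact (rpow_mul_rpow_le_rpowMajorant enorm_ne_top h (by rwa [add_comm])).trans le_add_self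

theorem lintegral_rpow_mul_rpow_sub {x : ℝ} (hx : x ≠ 0) :
    ∫⁻ t : ℝ, ‖t‖ₑ ^ (-(3 / 4) : ℝ) * ‖x - t‖ₑ ^ (-(3 / 4) : ℝ) =
      (∫⁻ t : ℝ, ‖t‖ₑ ^ (-(3 / 4) : ℝ) * ‖1 - t‖ₑ ^ (-(3 / 4) : ℝ)) *
        ‖x‖ₑ ^ (-(1 / 2) : ℝ) := by
  have hx0 : ‖x‖ₑ ≠ 0 := enorm_ne_zero.2 hx
  have hscale : ∀ t : ℝ, ‖x * t‖ₑ ^ (-(3 / 4) : ℝ) * ‖x - x * t‖ₑ ^ (-(3 / 4) : ℝ) =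
      ‖x‖ₑ ^ (-(3 / 2) : ℝ) * (‖t‖ₑ ^ (-(3 / 4) : ℝ) * ‖1 - t‖ₑ ^ (-(3 / 4) : ℝ)) := by
    intro t
    rw [show x - x * t = x * (1 - t) by ring, enorm_mul, enorm_mul,
      ENNReal.mul_rpow_of_ne_top enorm_ne_top enorm_ne_top,
      ENNReal.mul_rpow_of_ne_top enorm_ne_top enorm_ne_top,
      show (-(3 / 2) : ℝ) = -(3 / 4) + -(3 / 4) by norm_num,
      ENNReal.rpow_add _ _ hx0 enorm_ne_top]
    ring
  conv_lhs => rw [← Real.smul_map_volume_mul_left hx]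
  rw [lintegral_smul_measure, lintegral_map (by fun_prop) (by fun_prop)]
  simp_rw [hscale]
  rw [lintegral_const_mul _ (by fun_prop), smul_eq_mul, ← mul_assoc, mul_comm]
  congr 1
  rw [← Real.norm_eq_abs, ofReal_norm]
  nth_rewrite 1 [← ENNReal.rpow_one ‖x‖ₑ]
  rw [← ENNReal.rpow_add _ _ hx0 enorm_ne_top]
  norm_num

theorem ofReal_prod_abs {ι : Type*} (s : Finset ι) (x : ι → ℝ) :
    ENNReal.ofReal (∏ k ∈ s, |x k|) = ∏ k ∈ s, ‖x k‖ₑ := by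
  rw [ENNReal.ofReal_prod_of_nonneg fun _ _ => abs_nonneg _]
  simp_rw [← Real.norm_eq_abs, ofReal_norm]

/-- Two overlapping hyperbolic crosses, one centred at the origin and one at `x`, meet in a set of
measure at most a constant times the larger level, with no logarithmic loss. -/
theorem volume_prod_abs_le_inter_prod_abs_sub_le {n : ℕ} {x : Fin n → ℝ} (hx : ∀ k, x k ≠ 0)
    {ζ : ℝ} (hxζ : ∏ k, |x k| ≤ ζ) :
    volume {y : Fin n → ℝ | ∏ k, |y k| ≤ ∏ k, |x k| ∧ ∏ k, |x k - y k| ≤ ζ} ≤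
      (∫⁻ t : ℝ, ‖t‖ₑ ^ (-(3 / 4) : ℝ) * ‖1 - t‖ₑ ^ (-(3 / 4) : ℝ)) ^ n *
        ENNReal.ofReal ζ := by
  set K := ∫⁻ t : ℝ, ‖t‖ₑ ^ (-(3 / 4) : ℝ) * ‖1 - t‖ₑ ^ (-(3 / 4) : ℝ)
  set P := ENNReal.ofReal (∏ k, |x k|)
  set Z := ENNReal.ofReal ζ
  have hp : 0 < ∏ k, |x k| := Finset.prod_pos fun k _ => abs_pos.2 (hx k)
  have hP0 : P ≠ 0 := (ENNReal.ofReal_pos.2 hp).ne'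
  have hZ0 : Z ≠ 0 := (ENNReal.ofReal_pos.2 (hp.trans_le hxζ)).ne'
  have hPt : P ≠ ⊤ := ENNReal.ofReal_ne_top
  have hZt : Z ≠ ⊤ := ENNReal.ofReal_ne_top
  have hPZ : P ≤ Z := ENNReal.ofReal_le_ofReal hxζ
  let f : Fin n → ℝ → ℝ≥0∞ := fun k t => ‖t‖ₑ ^ (-(3 / 4) : ℝ) * ‖x k - t‖ₑ ^ (-(3 / 4) : ℝ)
  have hf : ∀ k, Measurable (f k) := fun k => by fun_prop
  have hint : ∫⁻ y : Fin n → ℝ, ∏ k, f k (y k) = K ^ n * P ^ (-(1 / 2) : ℝ) := by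
    rw [lintegral_fin_prod_volume f hf, Finset.prod_congr rfl fun k _ =>
      lintegral_rpow_mul_rpow_sub (hx k), Finset.prod_mul_distrib,
      ENNReal.prod_rpow_of_ne_top fun _ _ => enorm_ne_top, ← ofReal_prod_abs]
    simp [K, P]
  have hmarkov := mul_meas_ge_le_lintegral (μ := volume)
    (f := fun y : Fin n → ℝ => ∏ k, f k (y k))
    (Finset.measurable_fun_prod _ fun k _ => (hf k).comp (measurable_pi_apply k))
    (P ^ (-(3 / 4) : ℝ) * Z ^ (-(3 / 4) : ℝ))
  rw [hint] at hmarkov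
  have hsub : {y : Fin n → ℝ | ∏ k, |y k| ≤ ∏ k, |x k| ∧ ∏ k, |x k - y k| ≤ ζ} ⊆
      {y | P ^ (-(3 / 4) : ℝ) * Z ^ (-(3 / 4) : ℝ) ≤ ∏ k, f k (y k)} := by
    rintro y ⟨h1, h2⟩
    simp only [Set.mem_ofPred_eq, f]
    rw [Finset.prod_mul_distrib, ENNReal.prod_rpow_of_ne_top fun _ _ => enorm_ne_top,
      ENNReal.prod_rpow_of_ne_top fun _ _ => enorm_ne_top, ← ofReal_prod_abs,
      ← ofReal_prod_abs Finset.univ fun k => x k - y k]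
    exact mul_le_mul' (ENNReal.rpow_neg_le_rpow_neg (ENNReal.ofReal_le_ofReal h1) (by norm_num))
      (ENNReal.rpow_neg_le_rpow_neg (ENNReal.ofReal_le_ofReal h2) (by norm_num))
  refine (measure_mono hsub).trans ?_
  set V := volume {y : Fin n → ℝ | P ^ (-(3 / 4) : ℝ) * Z ^ (-(3 / 4) : ℝ) ≤ ∏ k, f k (y k)}
  have hcancel : ∀ {a : ℝ≥0∞}, a ≠ 0 → a ≠ ⊤ → a ^ (3 / 4 : ℝ) * a ^ (-(3 / 4) : ℝ) = 1 :=
    fun h0 ht => by rw [← ENNReal.rpow_add _ _ h0 ht]; simp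
  calc V = (P ^ (3 / 4 : ℝ) * P ^ (-(3 / 4) : ℝ)) * (Z ^ (3 / 4 : ℝ) * Z ^ (-(3 / 4) : ℝ)) * V := by
        rw [hcancel hP0 hPt, hcancel hZ0 hZt, one_mul, one_mul]
    _ = P ^ (3 / 4 : ℝ) * Z ^ (3 / 4 : ℝ) * (P ^ (-(3 / 4) : ℝ) * Z ^ (-(3 / 4) : ℝ) * V) := by
        ring
    _ ≤ P ^ (3 / 4 : ℝ) * Z ^ (3 / 4 : ℝ) * (K ^ n * P ^ (-(1 / 2) : ℝ)) := by gcongr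
    _ = K ^ n * (P ^ (1 / 4 : ℝ) * Z ^ (3 / 4 : ℝ)) := by
        rw [show (1 / 4 : ℝ) = 3 / 4 + -(1 / 2) by norm_num, ENNReal.rpow_add _ _ hP0 hPt]
        ring
    _ ≤ K ^ n * (Z ^ (1 / 4 : ℝ) * Z ^ (3 / 4 : ℝ)) := by gcongr
    _ = K ^ n * Z := by
        rw [← ENNReal.rpow_add _ _ hZ0 hZt]; norm_num

theorem stmt_11 (d : ℕ) (hd : 3 ≤ d) :
    ∃ C : ℝ, 0 < C ∧
      ∀ ζ : ℝ, 0 < ζ → ζ < 1 / 2 →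
      ∀ x : Fin d → ℝ, (∀ k, x k ∈ Set.Ioo (-1 : ℝ) 1) → (∀ k, x k ≠ 0) →
        (∏ k, |x k|) ≤ ζ →
        volume {y : Fin d → ℝ | (∀ k, y k ∈ Set.Ioo (-1 : ℝ) 1) ∧
            (∏ k, |y k|) ≤ ∏ k, |x k| ∧ (∏ k, |x k - y k|) ≤ ζ}
          ≤ ENNReal.ofReal (C * ζ * Real.log (1 / ζ) ^ (d - 2)) := by
  set K := ∫⁻ t : ℝ, ‖t‖ₑ ^ (-(3 / 4) : ℝ) * ‖1 - t‖ₑ ^ (-(3 / 4) : ℝ) with hK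
  have hKt : K ≠ ⊤ := lintegral_rpow_mul_rpow_one_sub_lt_top.ne
  have hlog2 : 0 < Real.log 2 := Real.log_pos one_lt_two
  refine ⟨(K.toReal ^ d + 1) / Real.log 2 ^ (d - 2), by positivity, ?_⟩
  intro ζ hζ hζ2 x _ hx0 hxζ
  refine (measure_mono fun y hy => hy.2).trans
    ((volume_prod_abs_le_inter_prod_abs_sub_le hx0 hxζ).trans ?_)
  rw [← hK, ← ENNReal.ofReal_toReal (ENNReal.pow_ne_top (n := d) hKt),
    ← ENNReal.ofReal_mul ENNReal.toReal_nonneg, ENNReal.toReal_pow]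
  refine ENNReal.ofReal_le_ofReal ?_
  have hlog : Real.log 2 ≤ Real.log (1 / ζ) := by
    refine Real.log_le_log two_pos ?_
    rw [le_div_iff₀ hζ]
    linarith
  have hone : 1 ≤ Real.log (1 / ζ) ^ (d - 2) / Real.log 2 ^ (d - 2) :=
    (one_le_div (by positivity)).2 (pow_le_pow_left₀ hlog2.le hlog _)
  calc K.toReal ^ d * ζ ≤ (K.toReal ^ d + 1) * ζ * 1 := by nlinarith
    _ ≤ (K.toReal ^ d + 1) * ζ * (Real.log (1 / ζ) ^ (d - 2) / Real.log 2 ^ (d - 2)) := by gcongr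
    _ = _ := by ring
end

section
/- Fix an integer d ≥ 3. There exists a constant C = C(d) > 0 such that for every ζ ∈ (0, 1/2) and every x ∈ (0,1)^d with ∏_{k=1}^d x_k ≤ ζ, the d-dimensional Lebesgue measure of the set { y ∈ (−1,1)^d : ∏_{k=1}^d |y_k| ≤ ∏_{k=1}^d x_k, ∏_{k=1}^d |x_k − y_k| ≤ ζ, and |y_k − x_k| > x_k/2 for every k ∈ {1,…,d} } is at most C · ζ. -/
open MeasureTheory

/-- An even integrable weight on `ℝ`: comparable to `|t| ^ (-1/2)` near `0` and to
`|t| ^ (-3/2)` at infinity. -/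
noncomputable def tailWeight (t : ℝ) : ℝ := (max 1 |t|)⁻¹ * |t| ^ (-(1 / 2) : ℝ)

theorem tailWeight_nonneg (t : ℝ) : 0 ≤ tailWeight t := by
  unfold tailWeight
  positivity

theorem tailWeight_neg (t : ℝ) : tailWeight (-t) = tailWeight t := by
  simp [tailWeight]

theorem integrableOn_tailWeight_Ioi : IntegrableOn tailWeight (Set.Ioi 0) := by
  rw [← Set.Ioc_union_Ioi_eq_Ioi (zero_le_one (α := ℝ))]
  refine IntegrableOn.union ?_ ?_
  · have h := (intervalIntegral.intervalIntegrable_rpow' (a := 0) (b := 1)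
      (r := (-(1 / 2) : ℝ)) (by norm_num)).1
    refine h.congr_fun (fun t ht => ?_) measurableSet_Ioc
    simp [tailWeight, abs_of_pos ht.1, max_eq_left ht.2]
  · have h := integrableOn_Ioi_rpow_of_lt (a := (-(3 / 2) : ℝ)) (by norm_num) zero_lt_one
    refine h.congr_fun (fun t ht => ?_) measurableSet_Ioi
    have ht1 : (1 : ℝ) < t := ht
    have ht0 : 0 < t := by linarith
    simp only [tailWeight, abs_of_pos ht0, max_eq_right ht1.le]
    rw [← Real.rpow_neg_one, ← Real.rpow_add ht0]
    norm_num

theorem integrable_tailWeight : Integrable tailWeight := by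
  rw [← integrableOn_univ, ← Set.Iic_union_Ioi (a := (0 : ℝ))]
  refine IntegrableOn.union ?_ integrableOn_tailWeight_Ioi
  have hm : MeasurableEmbedding (Neg.neg : ℝ → ℝ) := (Homeomorph.neg ℝ).measurableEmbedding
  have h : tailWeight ∘ Neg.neg = tailWeight := funext tailWeight_neg
  rw [← Measure.map_neg_eq_self (volume : Measure ℝ), hm.integrableOn_map_iff, h]
  simpa using Iff.mpr integrableOn_Ici_iff_integrableOn_Ioi integrableOn_tailWeight_Ioi

theorem le_tailWeight_div {a y : ℝ} (ha : 0 < a) (hy : a / 2 < |y - a|) :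
    a / (3 * |a - y|) * (|y| / a) ^ (-(1 / 2) : ℝ) ≤ tailWeight (y / a) := by
  rw [abs_sub_comm] at hy
  have h0 : 0 < |a - y| := by linarith
  have hy3 : |y| ≤ 3 * |a - y| := by
    have h := abs_sub_abs_le_abs_sub y a
    rw [abs_sub_comm y a, abs_of_pos ha] at h
    linarith
  unfold tailWeight
  rw [abs_div, abs_of_pos ha]
  refine mul_le_mul_of_nonneg_right ?_ (by positivity)
  rw [← inv_div]
  refine inv_anti₀ (by positivity) (max_le ?_ ?_)
  · rw [le_div_iff₀ ha]
    linarith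
  · gcongr

theorem le_prod_tailWeight_div {ι : Type*} [Fintype ι] {ζ : ℝ} {x y : ι → ℝ}
    (hx : ∀ k, 0 < x k) (hy0 : ∀ k, y k ≠ 0) (hyx : ∏ k, |y k| ≤ ∏ k, x k)
    (hζ : ∏ k, |x k - y k| ≤ ζ) (hfar : ∀ k, x k / 2 < |y k - x k|) :
    (∏ k, x k) / (3 ^ Fintype.card ι * ζ) ≤ ∏ k, tailWeight (y k / x k) := by
  have hxp : 0 < ∏ k, x k := Finset.prod_pos fun k _ => hx k
  have hyp : 0 < ∏ k, |y k| := Finset.prod_pos fun k _ => abs_pos.2 (hy0 k)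
  have hdp : 0 < ∏ k, |x k - y k| := Finset.prod_pos fun k _ => by
    have h := hfar k
    rw [abs_sub_comm] at h
    linarith [hx k]
  calc (∏ k, x k) / (3 ^ Fintype.card ι * ζ)
      ≤ (∏ k, x k) / (3 ^ Fintype.card ι * ∏ k, |x k - y k|) := by gcongr
    _ ≤ (∏ k, x k) / (3 ^ Fintype.card ι * ∏ k, |x k - y k|) *
          ((∏ k, |y k|) / ∏ k, x k) ^ (-(1 / 2) : ℝ) := by
        refine le_mul_of_one_le_right (by positivity) ?_
        exact Real.one_le_rpow_of_pos_of_le_one_of_nonpos (by positivity)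
          ((div_le_one hxp).2 hyx) (by norm_num)
    _ = ∏ k, x k / (3 * |x k - y k|) * (|y k| / x k) ^ (-(1 / 2) : ℝ) := by
        rw [Finset.prod_mul_distrib, Real.finsetProd_rpow _ _
          (fun k _ => div_nonneg (abs_nonneg _) (hx k).le), Finset.prod_div_distrib,
          Finset.prod_div_distrib, Finset.prod_mul_distrib, Finset.prod_const, Finset.card_univ]
    _ ≤ ∏ k, tailWeight (y k / x k) :=
        Finset.prod_le_prod
          (fun k _ => mul_nonneg (div_nonneg (hx k).le (by positivity))
            (Real.rpow_nonneg (div_nonneg (abs_nonneg _) (hx k).le) _))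
          (fun k _ => le_tailWeight_div (hx k) (hfar k))

theorem integral_prod_tailWeight_div {ι : Type*} [Fintype ι] {x : ι → ℝ} (hx : ∀ k, 0 < x k) :
    ∫ y : ι → ℝ, ∏ k, tailWeight (y k / x k) =
      (∏ k, x k) * (∫ t, tailWeight t) ^ Fintype.card ι := by
  rw [integral_fintype_prod_volume_eq_prod fun k t => tailWeight (t / x k)]
  simp_rw [Measure.integral_comp_div, smul_eq_mul, abs_of_pos (hx _)]
  rw [Finset.prod_mul_distrib, Finset.prod_const, Finset.card_univ]

theorem integrable_prod_tailWeight_div {ι : Type*} [Fintype ι] {x : ι → ℝ}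
    (hx : ∀ k, 0 < x k) : Integrable fun y : ι → ℝ => ∏ k, tailWeight (y k / x k) :=
  Integrable.fintype_prod (f := fun k t => tailWeight (t / x k))
    fun k => integrable_tailWeight.comp_div (hx k).ne'

theorem stmt_12 (d : ℕ) (hd : 3 ≤ d) :
    ∃ C : ℝ, 0 < C ∧
      ∀ ζ : ℝ, 0 < ζ → ζ < 1 / 2 →
      ∀ x : Fin d → ℝ, (∀ k, x k ∈ Set.Ioo (0 : ℝ) 1) →
        (∏ k, x k) ≤ ζ →
        volume {y : Fin d → ℝ | (∀ k, y k ∈ Set.Ioo (-1 : ℝ) 1) ∧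
            (∏ k, |y k|) ≤ (∏ k, x k) ∧ (∏ k, |x k - y k|) ≤ ζ ∧
            ∀ k, x k / 2 < |y k - x k|}
          ≤ ENNReal.ofReal (C * ζ) := by
  have hI : 0 ≤ ∫ t, tailWeight t := integral_nonneg tailWeight_nonneg
  refine ⟨3 ^ d * (∫ t, tailWeight t) ^ d + 1, by positivity, fun ζ hζ _ x hx _ => ?_⟩
  have hx0 : ∀ k, 0 < x k := fun k => (hx k).1
  have hxp : 0 < ∏ k, x k := Finset.prod_pos fun k _ => hx0 k
  set ε : ℝ := (∏ k, x k) / (3 ^ d * ζ) with hε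
  have hεpos : 0 < ε := by positivity
  have hF := integrable_prod_tailWeight_div hx0
  have hne : ∀ᵐ y : Fin d → ℝ, ∀ k, y k ≠ 0 :=
    ae_all_iff.2 fun k => Measure.ae_eval_ne (fun _ => volume) k 0
  have hmarkov := mul_meas_ge_le_integral_of_nonneg
    (Filter.Eventually.of_forall fun y => Finset.prod_nonneg fun k _ =>
      tailWeight_nonneg (y k / x k)) hF ε
  rw [integral_prod_tailWeight_div hx0, Fintype.card_fin, hε, div_mul_eq_mul_div,
    div_le_iff₀ (by positivity), mul_assoc, mul_le_mul_iff_right₀ hxp, ← hε] at hmarkov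
  calc _ ≤ volume {y : Fin d → ℝ | ε ≤ ∏ k, tailWeight (y k / x k)} := by
        refine measure_mono_ae ?_
        filter_upwards [hne] with y hy0 hy
        obtain ⟨-, hyx, hyζ, hfar⟩ := hy
        have h := le_prod_tailWeight_div hx0 hy0 hyx hyζ hfar
        rwa [Fintype.card_fin] at h
    _ = ENNReal.ofReal (volume.real {y : Fin d → ℝ | ε ≤ ∏ k, tailWeight (y k / x k)}) :=
        (ofReal_measureReal (hF.measure_ge_lt_top hεpos).ne).symm
    _ ≤ _ := by
        refine ENNReal.ofReal_le_ofReal (hmarkov.trans ?_)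
        linarith
end

section
/- Fix an integer d̂ ≥ 1. There exists k₀ = k₀(d̂) such that the following holds for all integers k ≥ k₀ and n ≥ k, every real T ∈ [1, √(log k)], every integer Q ∈ [1, k^{1/d̂}/4], every finite set Ω with |Ω| = Q, every function f : {1,…,n} → Ω, and every set X ⊆ {1,…,n} with |X| = k. Let p_1,…,p_n be independent uniformly random points in [0,1]^{d̂}, and for a pair (i,j) with i,j ∈ X, f(i) = f(j) and p_i ≺ p_j, define Box_f(i,j) = { ℓ ∈ {1,…,n} \ X : f(ℓ) = f(i) and p_i ≺ p_ℓ ≺ p_j }. Then with probability at least 1 − exp(−17^{−d̂}·k·T), there exists a collection 𝒳 of at least 8^{−d̂}·k pairs (i,j) ∈ X², pairwise disjoint as two-element sets of indices, each satisfying f(i) = f(j), p_i ≺ p_j, and |Box_f(i,j)| < (8n/k) · ( (1/8)·⌊ (log k) / (8·d̂²·T·log log k) ⌋ )^{1−d̂}. -/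
open MeasureTheory Filter

/-- The distribution of `n` independent uniformly random points in `[0,1]^d`. -/
noncomputable def unifCube (n d : ℕ) : Measure (Fin n → Fin d → ℝ) :=
  Measure.pi fun _ => Measure.pi fun _ => volume.restrict (Set.Icc (0:ℝ) 1)

/-- `x ≺ y`: every coordinate of `y` strictly dominates that of `x`. -/
def strictDom {d : ℕ} (x y : Fin d → ℝ) : Prop := ∀ k, x k < y k

/-- Distinct pairs of the collection share no entry. -/
def IsPairMatching {α : Type*} (S : Finset (α × α)) : Prop :=
  ∀ a ∈ S, ∀ b ∈ S, a ≠ b → a.1 ≠ b.1 ∧ a.1 ≠ b.2 ∧ a.2 ≠ b.1 ∧ a.2 ≠ b.2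

/-- There is a matching of at least `c` pairs satisfying `P`. -/
def HasMatching {α : Type*} (P : α → α → Prop) (c : ℝ) : Prop :=
  ∃ S : Finset (α × α), c ≤ (S.card : ℝ) ∧ IsPairMatching S ∧ ∀ a ∈ S, P a.1 a.2

theorem IsPairMatching.subset {α : Type*} {S S' : Finset (α × α)} (h : IsPairMatching S)
    (hS : S' ⊆ S) : IsPairMatching S' :=
  fun a ha b hb hab => h a (hS ha) b (hS hb) hab

theorem sum_sum_update {ι β : Type*} [Fintype ι] [DecidableEq ι] [Fintype β]
    (H : (ι → β) → ℝ) (i : ι) :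
    ∑ u, ∑ s, H (Function.update u i s) = Fintype.card β * ∑ u, H u := by
  classical
  let e : (ι → β) × β → (ι → β) × β := fun x => (Function.update x.1 i x.2, x.1 i)
  have he : Function.Involutive e := by
    rintro ⟨u, s⟩
    simp [e]
  rw [← Fintype.sum_prod_type' (f := fun u s => H (Function.update u i s))]
  have := Equiv.sum_comp he.toPerm (fun x : (ι → β) × β => H x.1)
  simp only [Function.Involutive.coe_toPerm, e] at this
  rw [this, Fintype.sum_prod_type, Finset.mul_sum]
  simp

theorem sum_prod_matching_le {ι β : Type*} [Fintype ι] [DecidableEq ι] [Fintype β] [Nonempty β]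
    (X : Finset ι) (G : ι × ι → (ι → β) → ℝ) (q : ℝ) (hG : ∀ a u, 0 ≤ G a u) (hq : 0 ≤ q)
    (P : Finset (ι × ι)) (hP : IsPairMatching P)
    (hX : ∀ a ∈ P, a.1 ∈ X ∧ a.2 ∈ X)
    (hloc : ∀ a ∈ P, ∀ m ∈ X, m ≠ a.1 → m ≠ a.2 → ∀ u s, G a (Function.update u m s) = G a u)
    (hsum : ∀ a ∈ P, ∀ u, ∑ s, ∑ t, G a (Function.update (Function.update u a.1 s) a.2 t)
      ≤ (Fintype.card β : ℝ) ^ 2 * q) :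
    ∑ u, ∏ a ∈ P, G a u ≤ q ^ P.card * (Fintype.card (ι → β) : ℝ) := by
  induction P using Finset.induction_on with
  | empty => simp
  | insert a P ha ih =>
    have hsub : P ⊆ insert a P := Finset.subset_insert a P
    have ih := ih (hP.subset hsub) (fun b hb => hX b (hsub hb)) (fun b hb => hloc b (hsub hb))
      (fun b hb => hsum b (hsub hb))
    have haP := Finset.mem_insert_self a P
    have hc : (0 : ℝ) < Fintype.card β := by exact_mod_cast Fintype.card_pos
    set F : (ι → β) → ℝ := fun u => ∏ c ∈ P, G c u with hF
    have hF0 : ∀ u, 0 ≤ F u := fun u => Finset.prod_nonneg fun c _ => hG c u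
    have hFu : ∀ u s t, F (Function.update (Function.update u a.1 s) a.2 t) = F u := by
      intro u s t
      refine Finset.prod_congr rfl fun c hc => ?_
      have hne : a ≠ c := fun h => ha (h ▸ hc)
      obtain ⟨h1, h2, h3, h4⟩ := hP a haP c (hsub hc) hne
      rw [hloc c (hsub hc) _ (hX a haP).2 h3 h4, hloc c (hsub hc) _ (hX a haP).1 h1 h2]
    have h1 : (Fintype.card β : ℝ) ^ 2 * ∑ u, G a u * F u
        ≤ (Fintype.card β : ℝ) ^ 2 * (q * ∑ u, F u) := by
      calc (Fintype.card β : ℝ) ^ 2 * ∑ u, G a u * F u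
          = ∑ u, ∑ s, ∑ t, (fun v => G a v * F v)
              (Function.update (Function.update u a.1 s) a.2 t) := by
            rw [sum_sum_update (fun v => ∑ t, (fun v => G a v * F v) (Function.update v a.2 t)),
              sum_sum_update (fun v => G a v * F v)]
            ring
        _ = ∑ u, F u * ∑ s, ∑ t, G a (Function.update (Function.update u a.1 s) a.2 t) := by
            refine Finset.sum_congr rfl fun u _ => ?_
            simp only [hFu, ← Finset.sum_mul, mul_comm (F u)]
        _ ≤ ∑ u, F u * ((Fintype.card β : ℝ) ^ 2 * q) :=
            Finset.sum_le_sum fun u _ => mul_le_mul_of_nonneg_left (hsum a haP u) (hF0 u)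
        _ = _ := by rw [← Finset.sum_mul]; ring
    have h2 : ∑ u, G a u * F u ≤ q * ∑ u, F u := le_of_mul_le_mul_left h1 (by positivity)
    calc ∑ u, ∏ c ∈ insert a P, G c u = ∑ u, G a u * F u := by
          simp only [Finset.prod_insert ha, hF]
      _ ≤ q * ∑ u, F u := h2
      _ ≤ q * (q ^ P.card * (Fintype.card (ι → β) : ℝ)) := mul_le_mul_of_nonneg_left ih hq
      _ = _ := by rw [Finset.card_insert_of_notMem ha, pow_succ]; ring

theorem exists_separated_pairs {ι Ω : Type*} [Fintype ι] [DecidableEq ι] [DecidableEq Ω]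
    (x : ι → ℝ) (hx : Function.Injective x) (f : ι → Ω) (S : Finset ι) :
    ∃ P : Finset (ι × ι), S.card ≤ 2 * P.card + (S.image f).card ∧ IsPairMatching P ∧
      (∀ a ∈ P, a.1 ∈ S ∧ a.2 ∈ S ∧ f a.1 = f a.2 ∧ x a.1 < x a.2) ∧
      ∀ a ∈ P, ∀ b ∈ P, a ≠ b → f a.1 = f b.1 → x a.2 < x b.1 ∨ x b.2 < x a.1 := by
  induction S using Finset.strongInduction with
  | H S ih =>
    by_cases hS : S.card ≤ (S.image f).card
    · exact ⟨∅, by simpa using hS, by simp [IsPairMatching], by simp, by simp⟩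
    · push Not at hS
      obtain ⟨i₀, hi₀, j₀, hj₀, hij₀, hf₀⟩ := Finset.exists_ne_map_eq_of_card_lt_of_maps_to hS
        (fun a ha => Finset.mem_image_of_mem f ha)
      let C : Finset (ι × ι) := (S ×ˢ S).filter fun a => f a.1 = f a.2 ∧ x a.1 < x a.2
      have hC : C.Nonempty := by
        rcases lt_or_gt_of_ne (hx.ne hij₀) with h | h
        · exact ⟨(i₀, j₀), by simp [C, *]⟩
        · exact ⟨(j₀, i₀), by simp [C, *]⟩
      obtain ⟨⟨i, j⟩, hijC, hmin⟩ := Finset.exists_min_image C (fun a => x a.2) hC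
      simp only [C, Finset.mem_filter, Finset.mem_product] at hijC
      obtain ⟨⟨hi, hj⟩, hfij, hxij⟩ := hijC
      have hne : i ≠ j := fun h => by simp [h] at hxij
      have hsub : (S.erase i).erase j ⊆ S :=
        (Finset.erase_subset _ _).trans (Finset.erase_subset _ _)
      have hcard : ((S.erase i).erase j).card + 2 = S.card := by
        rw [Finset.card_erase_of_mem (by simp [hj, hne.symm]), Finset.card_erase_of_mem hi]
        have : 1 < S.card := Finset.one_lt_card.2 ⟨i, hi, j, hj, hne⟩
        omega
      obtain ⟨P, hP1, hP2, hP3, hP4⟩ := ih _ (Finset.ssubset_iff_subset_ne.2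
        ⟨hsub, fun h => by rw [h] at hcard; omega⟩)
      have hmem : ∀ m ∈ (S.erase i).erase j, m ≠ i ∧ m ≠ j ∧ m ∈ S := by
        intro m hm
        simp only [Finset.mem_erase] at hm
        exact ⟨hm.2.1, hm.1, hm.2.2⟩
      have hlow : ∀ m ∈ (S.erase i).erase j, f m = f i → x j < x m := by
        intro m hm hfm
        obtain ⟨h1, h2, h3⟩ := hmem m hm
        by_contra hcon
        have hlt : x m < x j := lt_of_le_of_ne (not_lt.1 hcon) (hx.ne h2)
        rcases lt_or_gt_of_ne (hx.ne h1) with h | h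
        · have := hmin (m, i) (by simp [C, *])
          simp only at this
          linarith
        · have := hmin (i, m) (by simp [C, *])
          simp only at this
          linarith
      have hnew : ∀ a ∈ P, (i ≠ a.1 ∧ i ≠ a.2 ∧ j ≠ a.1 ∧ j ≠ a.2) := by
        intro a ha
        obtain ⟨h1, h2, _⟩ := hP3 a ha
        exact ⟨(hmem _ h1).1.symm, (hmem _ h2).1.symm, (hmem _ h1).2.1.symm, (hmem _ h2).2.1.symm⟩
      have hnot : (i, j) ∉ P := fun h => (hnew _ h).1 rfl
      refine ⟨insert (i, j) P, ?_, ?_, ?_, ?_⟩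
      · rw [Finset.card_insert_of_notMem hnot]
        have := Finset.card_le_card (Finset.image_subset_image (f := f) hsub)
        omega
      · intro a ha b hb hab
        rcases Finset.mem_insert.1 ha with rfl | ha <;> rcases Finset.mem_insert.1 hb with rfl | hb
        · exact absurd rfl hab
        · exact hnew b hb
        · obtain ⟨h1, h2, h3, h4⟩ := hnew a ha
          exact ⟨h1.symm, h3.symm, h2.symm, h4.symm⟩
        · exact hP2 a ha b hb hab
      · intro a ha
        rcases Finset.mem_insert.1 ha with rfl | ha
        · exact ⟨hi, hj, hfij, hxij⟩
        · obtain ⟨h1, h2, h3⟩ := hP3 a ha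
          exact ⟨hsub h1, hsub h2, h3⟩
      · intro a ha b hb hab hf
        rcases Finset.mem_insert.1 ha with rfl | ha <;> rcases Finset.mem_insert.1 hb with rfl | hb
        · exact absurd rfl hab
        · exact Or.inl (hlow _ (hP3 b hb).1 hf.symm)
        · exact Or.inr (hlow _ (hP3 a ha).1 hf)
        · exact hP4 a ha b hb hab hf

/-- `i` and `j` are marked indices on the same level, related by `rel`, with fewer than `t`
unmarked indices of that level in between. -/
def SparsePair {ι Ω : Type*} (rel : ι → ι → Prop) (f : ι → Ω) (X : Finset ι) (t : ℝ)
    (i j : ι) : Prop :=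
  i ∈ X ∧ j ∈ X ∧ f i = f j ∧ rel i j ∧
    (({ℓ : ι | ℓ ∉ X ∧ f ℓ = f i ∧ rel i ℓ ∧ rel ℓ j}).ncard : ℝ) < t

theorem card_filter_le_mul {α : Type*} (P : Finset α) (c : α → ℕ) (t r : ℝ) (n : ℕ)
    (h : ∑ a ∈ P, c a ≤ n) (hr : (n : ℝ) ≤ r * t) (ht : 0 < t) :
    ((P.filter fun a => ¬ (c a : ℝ) < t).card : ℝ) ≤ r := by
  have h1 : ((P.filter fun a => ¬ (c a : ℝ) < t).card : ℝ) * t ≤ n := by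
    calc ((P.filter fun a => ¬ (c a : ℝ) < t).card : ℝ) * t
        = ∑ a ∈ P.filter (fun a => ¬ (c a : ℝ) < t), t := by simp
      _ ≤ ∑ a ∈ P.filter (fun a => ¬ (c a : ℝ) < t), (c a : ℝ) :=
          Finset.sum_le_sum fun a ha => not_lt.1 (Finset.mem_filter.1 ha).2
      _ ≤ ∑ a ∈ P, (c a : ℝ) :=
          Finset.sum_le_sum_of_subset_of_nonneg (Finset.filter_subset _ _) fun _ _ _ => by positivity
      _ ≤ n := by exact_mod_cast h
  exact le_of_mul_le_mul_right (h1.trans hr) ht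

theorem hasMatching_of_injective {n : ℕ} {Ω : Type*} [DecidableEq Ω]
    (x : Fin n → ℝ) (hx : Function.Injective x) (f : Fin n → Ω) (X : Finset (Fin n))
    (hX : 0 < X.card) (hq : 4 * (X.image f).card ≤ X.card) :
    HasMatching (SparsePair (fun i j => x i < x j) f X (8 * n / X.card)) ((8 : ℝ)⁻¹ * X.card) := by
  classical
  obtain ⟨P, hP1, hP2, hP3, hP4⟩ := exists_separated_pairs x hx f X
  let B : Fin n × Fin n → Finset (Fin n) := fun a =>
    Finset.univ.filter fun ℓ => ℓ ∉ X ∧ f ℓ = f a.1 ∧ x a.1 < x ℓ ∧ x ℓ < x a.2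
  have hB : ∀ a, ({ℓ | ℓ ∉ X ∧ f ℓ = f a.1 ∧ x a.1 < x ℓ ∧ x ℓ < x a.2} : Set (Fin n)).ncard
      = (B a).card := by
    intro a
    rw [← Set.ncard_coe_finset]
    simp [B]
  have hdisj : ∑ a ∈ P, (B a).card ≤ n := by
    rw [← Finset.card_biUnion]
    · simpa using Finset.card_le_univ (P.biUnion B)
    · intro a ha b hb hab
      rw [Function.onFun, Finset.disjoint_left]
      intro ℓ hla hlb
      simp only [B, Finset.mem_filter, Finset.mem_univ, true_and] at hla hlb
      rcases hP4 a ha b hb hab (hla.2.1.symm.trans hlb.2.1) with h | h <;> linarith [hla.2.2.1,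
        hla.2.2.2, hlb.2.2.1, hlb.2.2.2]
  have hk : (0 : ℝ) < X.card := by exact_mod_cast hX
  have hn : 0 < n := lt_of_lt_of_le hX (by simpa using Finset.card_le_univ X)
  have hn' : (0 : ℝ) < n := by exact_mod_cast hn
  have ht : (0 : ℝ) < 8 * n / X.card := by positivity
  have hbad := card_filter_le_mul P (fun a => (B a).card) (8 * n / X.card) (X.card / 8) n hdisj
    (by field_simp; exact le_refl _) ht
  refine ⟨P.filter fun a => ((B a).card : ℝ) < 8 * n / X.card, ?_,
    hP2.subset (Finset.filter_subset _ _), ?_⟩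
  · have := Finset.card_filter_add_card_filter_not (s := P)
      (fun a => ((B a).card : ℝ) < 8 * n / X.card)
    have h1 : (((P.filter fun a => ((B a).card : ℝ) < 8 * n / X.card).card : ℝ)
      + ((P.filter fun a => ¬ ((B a).card : ℝ) < 8 * n / X.card).card : ℝ)) = P.card := by
      exact_mod_cast this
    have h2 : (X.card : ℝ) ≤ 2 * P.card + (X.image f).card := by exact_mod_cast hP1
    have h3 : (4 : ℝ) * (X.image f).card ≤ X.card := by exact_mod_cast hq
    linarith
  · intro a ha
    obtain ⟨ha, hlt⟩ := Finset.mem_filter.1 ha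
    obtain ⟨h1, h2, h3, h4⟩ := hP3 a ha
    exact ⟨h1, h2, h3, h4, by rw [hB]; exact hlt⟩

/-- The size of the largest matching whose pairs satisfy `P`. -/
noncomputable def matchNum {ι : Type*} [Fintype ι] (P : ι → ι → Prop) : ℕ := by
  classical
  exact ((Finset.univ : Finset (Finset (ι × ι))).filter
    fun S => IsPairMatching S ∧ ∀ a ∈ S, P a.1 a.2).sup Finset.card

theorem card_le_matchNum {ι : Type*} [Fintype ι] {P : ι → ι → Prop} {S : Finset (ι × ι)}
    (h1 : IsPairMatching S) (h2 : ∀ a ∈ S, P a.1 a.2) : S.card ≤ matchNum P := by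
  classical
  unfold matchNum
  exact Finset.le_sup (f := Finset.card) (by simp [h1]; simpa using h2)

theorem exists_card_eq_matchNum {ι : Type*} [Fintype ι] (P : ι → ι → Prop) :
    ∃ S : Finset (ι × ι), S.card = matchNum P ∧ IsPairMatching S ∧ ∀ a ∈ S, P a.1 a.2 := by
  classical
  have hne : ((Finset.univ : Finset (Finset (ι × ι))).filter
      fun S => IsPairMatching S ∧ ∀ a ∈ S, P a.1 a.2).Nonempty :=
    ⟨∅, by simp [IsPairMatching]⟩
  obtain ⟨S, hS, hmax⟩ := Finset.exists_max_image _ Finset.card hne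
  have hS' := (Finset.mem_filter.1 hS).2
  refine ⟨S, le_antisymm (card_le_matchNum hS'.1 hS'.2) ?_, hS'⟩
  unfold matchNum
  exact Finset.sup_le hmax

/-- `i` and `j` are marked indices on the same level, related by `rel`, with `z i < z j` and fewer
than `t` unmarked indices of that level weakly between for `z` and strictly between for `rel`. -/
def CertPair {ι Ω : Type*} (rel : ι → ι → Prop) (f : ι → Ω) (X : Finset ι) (t : ℝ)
    (z : ι → ℕ) (i j : ι) : Prop :=
  i ∈ X ∧ j ∈ X ∧ f i = f j ∧ z i < z j ∧ rel i j ∧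
    (({ℓ : ι | ℓ ∉ X ∧ f ℓ = f i ∧ z i ≤ z ℓ ∧ z ℓ ≤ z j ∧ rel i ℓ ∧ rel ℓ j}).ncard : ℝ) < t

/-- Append a base-`b` digit to every entry of `z`. -/
def appendDigits {ι : Type*} {b : ℕ} (z : ι → ℕ) (u : ι → Fin b) : ι → ℕ :=
  fun i => b * z i + u i

theorem appendDigits_div {ι : Type*} {b : ℕ} (z : ι → ℕ) (u : ι → Fin b) (i : ι) :
    appendDigits z u i / b = z i := by
  have hb : 0 < b := lt_of_le_of_lt (Nat.zero_le _) (u i).isLt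
  simp [appendDigits, Nat.mul_add_div hb]

theorem CertPair.appendDigits {ι Ω : Type*} [Finite ι] {rel : ι → ι → Prop} {f : ι → Ω}
    {X : Finset ι} {t : ℝ} {z : ι → ℕ} {i j : ι} (h : CertPair rel f X t z i j) {b : ℕ}
    (u : ι → Fin b) : CertPair rel f X t (appendDigits z u) i j := by
  obtain ⟨h1, h2, h3, h4, h5, h6⟩ := h
  have hmono : ∀ m l, _root_.appendDigits z u m ≤ _root_.appendDigits z u l → z m ≤ z l := by
    intro m l hml
    have := Nat.div_le_div_right (c := b) hml
    rwa [appendDigits_div, appendDigits_div] at this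
  refine ⟨h1, h2, h3, ?_, h5, lt_of_le_of_lt ?_ h6⟩
  · by_contra hcon
    exact absurd (hmono _ _ (not_lt.1 hcon)) (not_le.2 h4)
  · refine Nat.cast_le.2 (Set.ncard_le_ncard ?_ (Set.toFinite _))
    rintro ℓ ⟨a1, a2, a3, a4, a5⟩
    exact ⟨a1, a2, hmono _ _ a3, hmono _ _ a4, a5⟩

theorem card_good_digits {ι Ω : Type*} [Fintype ι] [DecidableEq ι]
    {rel : ι → ι → Prop} {f : ι → Ω} {X : Finset ι} {t t' : ℝ} {M : ℕ} (hM : 0 < M)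
    (ht' : 0 < t') (htt : 2 * t' / M ≤ t) {z : ι → ℕ} {i j : ι} (hij : i ≠ j)
    (h : SparsePair rel (fun i => (f i, z i)) X t' i j) (u : ι → Fin (2 * M))
    [DecidablePred fun st : Fin (2 * M) × Fin (2 * M) => CertPair rel f X t
      (appendDigits z (Function.update (Function.update u i st.1) j st.2)) i j] :
    (M : ℝ) / 2 ≤ ((Finset.univ.filter fun st : Fin (2 * M) × Fin (2 * M) =>
      CertPair rel f X t
        (appendDigits z (Function.update (Function.update u i st.1) j st.2)) i j).card : ℝ) := by
  classical
  obtain ⟨hi, hj, hf, hrel, hcard⟩ := h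
  simp only [Prod.mk.injEq] at hf hcard
  have hM' : (0 : ℝ) < M := by exact_mod_cast hM
  let B : Finset ι := Finset.univ.filter fun ℓ => ℓ ∉ X ∧ (f ℓ = f i ∧ z ℓ = z i) ∧ rel i ℓ ∧ rel ℓ j
  have hB : (B.card : ℝ) < t' := by
    rw [← Set.ncard_coe_finset]
    simpa [B] using hcard
  let c : Fin M → ℕ := fun m => (B.filter fun ℓ => (u ℓ : ℕ) / 2 = m).card
  have hc : ∑ m ∈ Finset.univ, c m ≤ B.card := by
    rw [← Finset.card_biUnion]
    · exact Finset.card_le_card (by simp)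
    · intro a _ b _ hab
      rw [Function.onFun, Finset.disjoint_left]
      intro ℓ ha hb
      simp only [Finset.mem_filter] at ha hb
      exact hab (Fin.ext (ha.2.symm.trans hb.2))
  have hbad := card_filter_le_mul Finset.univ c (2 * t' / M) (M / 2) B.card hc
    (by field_simp; exact hB.le) (by positivity)
  have hgood : (M : ℝ) / 2 ≤ ((Finset.univ.filter fun m => (c m : ℝ) < 2 * t' / M).card : ℝ) := by
    have := Finset.card_filter_add_card_filter_not (s := (Finset.univ : Finset (Fin M)))
      (fun m => (c m : ℝ) < 2 * t' / M)
    have h1 : (((Finset.univ.filter fun m => (c m : ℝ) < 2 * t' / M).card : ℝ)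
      + ((Finset.univ.filter fun m => ¬ (c m : ℝ) < 2 * t' / M).card : ℝ)) = M := by
      rw [Finset.card_univ, Fintype.card_fin] at this
      exact_mod_cast this
    linarith
  refine hgood.trans ?_
  norm_cast
  refine Finset.card_le_card_of_injOn
    (fun m => (⟨2 * m, by omega⟩, ⟨2 * m + 1, by omega⟩)) ?_ ?_
  · intro m hm
    have hm : (c m : ℝ) < 2 * t' / M := by simpa using hm
    simp only [Finset.coe_filter, Finset.mem_univ, true_and, Set.mem_ofPred_eq]
    have hvi : ∀ s r : Fin (2 * M), appendDigits z
        (Function.update (Function.update u i s) j r) i = 2 * M * z i + s := by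
      intro s r
      simp [appendDigits, Function.update_of_ne hij]
    have hvj : ∀ s r : Fin (2 * M), appendDigits z
        (Function.update (Function.update u i s) j r) j = 2 * M * z j + r := by
      intro s r
      simp [appendDigits]
    refine ⟨hi, hj, hf.1, ?_, hrel, lt_of_le_of_lt ?_ (hm.trans_le htt)⟩
    · rw [hvi, hvj, hf.2]
      simp
    · rw [hvi, hvj, ← hf.2]
      simp only [c]
      rw [← Set.ncard_coe_finset]
      refine Nat.cast_le.2 (Set.ncard_le_ncard ?_ (Set.toFinite _))
      rintro ℓ ⟨a1, a2, a3, a4, a5, a6⟩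
      have hne1 : ℓ ≠ i := fun h => a1 (h ▸ hi)
      have hne2 : ℓ ≠ j := fun h => a1 (h ▸ hj)
      simp only [appendDigits, Function.update_of_ne hne1, Function.update_of_ne hne2] at a3 a4
      have hz : z ℓ = z i := by
        have h1 := Nat.div_le_div_right (c := 2 * M) a3
        have h2 := Nat.div_le_div_right (c := 2 * M) a4
        have hp : 0 < 2 * M := by omega
        rw [Nat.mul_add_div hp, Nat.mul_add_div hp, Nat.div_eq_of_lt (by omega),
          Nat.div_eq_of_lt (u ℓ).isLt] at h1
        rw [Nat.mul_add_div hp, Nat.mul_add_div hp, Nat.div_eq_of_lt (a := 2 * (m : ℕ) + 1)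
          (by omega), Nat.div_eq_of_lt (u ℓ).isLt] at h2
        omega
      rw [hz] at a3 a4
      simp only [Finset.coe_filter, Set.mem_ofPred_eq, B, Finset.mem_filter, Finset.mem_univ,
        true_and]
      exact ⟨⟨a1, ⟨a2, hz⟩, a5, a6⟩, by omega⟩
  · intro m _ m' _ h
    simp only [Prod.mk.injEq, Fin.mk.injEq] at h
    exact Fin.ext (by omega)

theorem sum_exp_certPair_le {ι Ω : Type*} [Fintype ι] [DecidableEq ι]
    {rel : ι → ι → Prop} {f : ι → Ω} {X : Finset ι} {t t' : ℝ} {M : ℕ} (hM : 0 < M)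
    (ht' : 0 < t') (htt : 2 * t' / M ≤ t) {z : ι → ℕ} {i j : ι} (hij : i ≠ j)
    (h : SparsePair rel (fun i => (f i, z i)) X t' i j) (u : ι → Fin (2 * M))
    [∀ v : ι → Fin (2 * M), Decidable (CertPair rel f X t (appendDigits z v) i j)] :
    ∑ s, ∑ r, (if CertPair rel f X t (appendDigits z
        (Function.update (Function.update u i s) j r)) i j then Real.exp (-1) else 1)
      ≤ (Fintype.card (Fin (2 * M)) : ℝ) ^ 2 * Real.exp (-(1 / (16 * M))) := by
  have hM' : (0 : ℝ) < M := by exact_mod_cast hM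
  have hcard := card_good_digits hM ht' htt hij h u
  set A := Finset.univ.filter fun st : Fin (2 * M) × Fin (2 * M) => CertPair rel f X t
      (appendDigits z (Function.update (Function.update u i st.1) j st.2)) i j with hA
  have he : Real.exp (-1) ≤ 1 / 2 := by
    have := Real.exp_neg_one_lt_half
    linarith
  calc ∑ s, ∑ r, (if CertPair rel f X t (appendDigits z
        (Function.update (Function.update u i s) j r)) i j then Real.exp (-1) else 1)
      = ∑ st : Fin (2 * M) × Fin (2 * M), (if CertPair rel f X t (appendDigits z
        (Function.update (Function.update u i st.1) j st.2)) i j then Real.exp (-1) else 1) :=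
        (Fintype.sum_prod_type (f := fun st : Fin (2 * M) × Fin (2 * M) =>
          if CertPair rel f X t (appendDigits z
            (Function.update (Function.update u i st.1) j st.2)) i j then Real.exp (-1) else 1)).symm
    _ ≤ ∑ st : Fin (2 * M) × Fin (2 * M), (1 - if CertPair rel f X t (appendDigits z
        (Function.update (Function.update u i st.1) j st.2)) i j then (1 / 2 : ℝ) else 0) := by
        refine Finset.sum_le_sum fun st _ => ?_
        split_ifs <;> linarith
    _ = (2 * M : ℝ) ^ 2 - A.card * (1 / 2) := by
        rw [Finset.sum_sub_distrib, ← Finset.sum_filter, ← hA]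
        simp
        ring
    _ ≤ (2 * M : ℝ) ^ 2 * (1 - 1 / (16 * M)) := by
        have : (2 * M : ℝ) ^ 2 * (1 - 1 / (16 * M)) = (2 * M : ℝ) ^ 2 - M / 4 := by
          field_simp
          ring
        rw [this]
        linarith
    _ ≤ (2 * M : ℝ) ^ 2 * Real.exp (-(1 / (16 * M))) := by
        have := Real.add_one_le_exp (-(1 / (16 * M : ℝ)))
        gcongr
        linarith
    _ = _ := by simp

theorem IsPairMatching.card_filter_disjoint {ι : Type*} [DecidableEq ι]
    {S R : Finset (ι × ι)} (hS : IsPairMatching S) :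
    S.card ≤ (S.filter fun a => ∀ b ∈ R, a.1 ≠ b.1 ∧ a.1 ≠ b.2 ∧ a.2 ≠ b.1 ∧ a.2 ≠ b.2).card
      + 2 * R.card := by
  classical
  let J := R.image Prod.fst ∪ R.image Prod.snd
  have hJ : J.card ≤ 2 * R.card := by
    refine (Finset.card_union_le _ _).trans ?_
    have h1 := Finset.card_image_le (s := R) (f := Prod.fst)
    have h2 := Finset.card_image_le (s := R) (f := Prod.snd)
    omega
  rw [← Finset.card_filter_add_card_filter_not (s := S)
    (fun a => ∀ b ∈ R, a.1 ≠ b.1 ∧ a.1 ≠ b.2 ∧ a.2 ≠ b.1 ∧ a.2 ≠ b.2)]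
  refine Nat.add_le_add_left (le_trans ?_ hJ) _
  refine Finset.card_le_card_of_injOn (fun a => if a.1 ∈ J then a.1 else a.2) ?_ ?_
  · intro a ha
    obtain ⟨-, ha⟩ := Finset.mem_filter.1 ha
    by_cases h : a.1 ∈ J
    · simp only [if_pos h]
      exact h
    · simp only [if_neg h]
      by_contra h2
      refine ha fun b hb => ?_
      have hb1 : b.1 ∈ J := Finset.mem_union_left _ (Finset.mem_image_of_mem _ hb)
      have hb2 : b.2 ∈ J := Finset.mem_union_right _ (Finset.mem_image_of_mem _ hb)
      exact ⟨fun e => h (e ▸ hb1), fun e => h (e ▸ hb2), fun e => h2 (e ▸ hb1),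
        fun e => h2 (e ▸ hb2)⟩
  · intro a ha b hb hab
    by_contra hne
    obtain ⟨h1, h2, h3, h4⟩ := hS a (Finset.mem_filter.1 ha).1 b (Finset.mem_filter.1 hb).1 hne
    simp only at hab
    split_ifs at hab
    · exact h1 hab
    · exact h2 hab
    · exact h3 hab
    · exact h4 hab

/-- An upper bound for the failure probability when `s` pairs are wanted, the pairs satisfying `P`
are available already and the digits still to be revealed are worth `c`. -/
noncomputable def failBound {ι : Type*} [Fintype ι] (s c : ℝ) (P : ι → ι → Prop) : ℝ :=
  if s ≤ matchNum P then 0 else min 1 (Real.exp (s - matchNum P - c))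

theorem failBound_nonneg {ι : Type*} [Fintype ι] (s c : ℝ) (P : ι → ι → Prop) :
    0 ≤ failBound s c P := by
  unfold failBound
  split_ifs
  · exact le_rfl
  · positivity

theorem failBound_le_one {ι : Type*} [Fintype ι] (s c : ℝ) (P : ι → ι → Prop) :
    failBound s c P ≤ 1 := by
  unfold failBound
  split_ifs
  · exact zero_le_one
  · exact min_le_left _ _

theorem failBound_le_exp {ι : Type*} [Fintype ι] (s c : ℝ) (P : ι → ι → Prop) :
    failBound s c P ≤ Real.exp (s - matchNum P - c) := by
  unfold failBound
  split_ifs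
  · positivity
  · exact min_le_right _ _

theorem sum_failBound_le {ι Ω : Type*} [Fintype ι] [DecidableEq ι]
    {rel : ι → ι → Prop} (hrel : ∀ i, ¬ rel i i) {f : ι → Ω} {X : Finset ι} {t t' s : ℝ} {M : ℕ}
    (hM : 0 < M) (ht' : 0 < t') (htt : 2 * t' / M ≤ t) {z : ι → ℕ}
    (hok : HasMatching (SparsePair rel (fun i => (f i, z i)) X t') (8 * s)) (c : ℝ) :
    ∑ u : ι → Fin (2 * M), failBound s c (CertPair rel f X t (appendDigits z u))
      ≤ (Fintype.card (ι → Fin (2 * M)) : ℝ)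
        * failBound s (c + 6 * s / (16 * M)) (CertPair rel f X t z) := by
  classical
  have : Nonempty (Fin (2 * M)) := ⟨⟨0, by omega⟩⟩
  have hM' : (0 : ℝ) < M := by exact_mod_cast hM
  obtain ⟨R, hRcard, hR, hRP⟩ := exists_card_eq_matchNum (CertPair rel f X t z)
  by_cases hs : s ≤ matchNum (CertPair rel f X t z)
  · have h0 : ∀ u : ι → Fin (2 * M),
        failBound s c (CertPair rel f X t (appendDigits z u)) = 0 := by
      intro u
      have := card_le_matchNum hR fun a ha => (hRP a ha).appendDigits u
      rw [hRcard] at this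
      have : (matchNum (CertPair rel f X t z) : ℝ)
          ≤ matchNum (CertPair rel f X t (appendDigits z u)) := by exact_mod_cast this
      simp [failBound, hs.trans this]
    rw [Finset.sum_congr rfl fun u _ => h0 u, Finset.sum_const_zero]
    exact mul_nonneg (by positivity) (failBound_nonneg _ _ _)
  · have hv : failBound s (c + 6 * s / (16 * M)) (CertPair rel f X t z) = min 1
        (Real.exp (s - matchNum (CertPair rel f X t z) - (c + 6 * s / (16 * M)))) := by
      simp [failBound, hs]
    rw [hv, mul_min_of_nonneg _ _ (by positivity)]
    refine le_min ?_ ?_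
    · calc _ ≤ ∑ u : ι → Fin (2 * M), (1 : ℝ) :=
            Finset.sum_le_sum fun u _ => failBound_le_one _ _ _
        _ = _ := by simp
    obtain ⟨S, hScard, hS, hSP⟩ := hok
    let S' := S.filter fun a => ∀ b ∈ R, a.1 ≠ b.1 ∧ a.1 ≠ b.2 ∧ a.2 ≠ b.1 ∧ a.2 ≠ b.2
    have hS'sub : S' ⊆ S := Finset.filter_subset _ _
    have hS'card : 6 * s ≤ S'.card := by
      have h1 : (S.card : ℝ) ≤ S'.card + 2 * R.card := by
        exact_mod_cast hS.card_filter_disjoint (R := R)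
      rw [hRcard] at h1
      push Not at hs
      linarith
    let G : ι × ι → (ι → Fin (2 * M)) → ℝ := fun a u =>
      if CertPair rel f X t (appendDigits z u) a.1 a.2 then Real.exp (-1) else 1
    have hG : ∀ a u, 0 ≤ G a u := by
      intro a u
      simp only [G]
      split_ifs <;> positivity
    have hne : ∀ a ∈ S', a.1 ≠ a.2 := by
      intro a ha h
      have := (hSP a (hS'sub ha)).2.2.2.1
      rw [h] at this
      exact hrel _ this
    have hmain := sum_prod_matching_le X G (Real.exp (-(1 / (16 * M)))) hG (by positivity) S'
      (hS.subset hS'sub) (fun a ha => ⟨(hSP a (hS'sub ha)).1, (hSP a (hS'sub ha)).2.1⟩)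
      (by
        intro a ha m hm h1 h2 u v
        have happ : ∀ ℓ, ℓ ≠ m → appendDigits z (Function.update u m v) ℓ
            = appendDigits z u ℓ := by
          intro ℓ hℓ
          simp [appendDigits, Function.update_of_ne hℓ]
        have hset : {ℓ : ι | ℓ ∉ X ∧ f ℓ = f a.1 ∧ appendDigits z u a.1
              ≤ appendDigits z (Function.update u m v) ℓ ∧
              appendDigits z (Function.update u m v) ℓ ≤ appendDigits z u a.2 ∧
              rel a.1 ℓ ∧ rel ℓ a.2}
            = {ℓ : ι | ℓ ∉ X ∧ f ℓ = f a.1 ∧ appendDigits z u a.1 ≤ appendDigits z u ℓ ∧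
              appendDigits z u ℓ ≤ appendDigits z u a.2 ∧ rel a.1 ℓ ∧ rel ℓ a.2} := by
          ext ℓ
          by_cases hℓ : ℓ = m
          · simp [hℓ, hm]
          · simp [happ ℓ hℓ]
        exact if_congr (by simp only [CertPair, happ _ h1.symm, happ _ h2.symm, hset]) rfl rfl)
      (fun a ha u => sum_exp_certPair_le hM ht' htt (hne a ha) (hSP a (hS'sub ha)) u)
    have hpoint : ∀ u : ι → Fin (2 * M), failBound s c (CertPair rel f X t (appendDigits z u))
        ≤ Real.exp (s - matchNum (CertPair rel f X t z) - c) * ∏ a ∈ S', G a u := by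
      intro u
      let D := S'.filter fun a => CertPair rel f X t (appendDigits z u) a.1 a.2
      have hprod : ∏ a ∈ S', G a u = Real.exp (-(D.card : ℝ)) := by
        simp only [G]
        rw [Finset.prod_ite]
        simp only [Finset.prod_const, one_pow, mul_one]
        rw [← Real.exp_nat_mul]
        simp [D]
      have hdisj : Disjoint R D := by
        rw [Finset.disjoint_left]
        intro a ha hD
        exact ((Finset.mem_filter.1 (Finset.mem_filter.1 hD).1).2 a ha).1 rfl
      have hnum : (R ∪ D).card ≤ matchNum (CertPair rel f X t (appendDigits z u)) := by
        have hcross : ∀ a ∈ D, ∀ b ∈ R, a.1 ≠ b.1 ∧ a.1 ≠ b.2 ∧ a.2 ≠ b.1 ∧ a.2 ≠ b.2 :=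
          fun a ha => (Finset.mem_filter.1 (Finset.mem_filter.1 ha).1).2
        refine card_le_matchNum ?_ ?_
        · intro a ha b hb hab
          rcases Finset.mem_union.1 ha with ha | ha <;> rcases Finset.mem_union.1 hb with hb | hb
          · exact hR a ha b hb hab
          · obtain ⟨h1, h2, h3, h4⟩ := hcross b hb a ha
            exact ⟨h1.symm, h3.symm, h2.symm, h4.symm⟩
          · exact hcross a ha b hb
          · exact hS a (hS'sub (Finset.mem_filter.1 ha).1) b
              (hS'sub (Finset.mem_filter.1 hb).1) hab
        · intro a ha
          rcases Finset.mem_union.1 ha with ha | ha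
          · exact (hRP a ha).appendDigits u
          · exact (Finset.mem_filter.1 ha).2
      rw [Finset.card_union_of_disjoint hdisj, hRcard] at hnum
      have hnum' : (matchNum (CertPair rel f X t z) : ℝ) + D.card
          ≤ matchNum (CertPair rel f X t (appendDigits z u)) := by exact_mod_cast hnum
      refine (failBound_le_exp _ _ _).trans ?_
      rw [hprod, ← Real.exp_add]
      exact Real.exp_le_exp.2 (by linarith)
    calc _ ≤ ∑ u : ι → Fin (2 * M),
          Real.exp (s - matchNum (CertPair rel f X t z) - c) * ∏ a ∈ S', G a u :=
          Finset.sum_le_sum fun u _ => hpoint u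
      _ = Real.exp (s - matchNum (CertPair rel f X t z) - c) * ∑ u, ∏ a ∈ S', G a u := by
          rw [Finset.mul_sum]
      _ ≤ Real.exp (s - matchNum (CertPair rel f X t z) - c) *
          (Real.exp (-(1 / (16 * M))) ^ S'.card * (Fintype.card (ι → Fin (2 * M)) : ℝ)) :=
          mul_le_mul_of_nonneg_left hmain (by positivity)
      _ = (Fintype.card (ι → Fin (2 * M)) : ℝ) * Real.exp
          (s - matchNum (CertPair rel f X t z) - c - S'.card / (16 * M)) := by
          rw [← Real.exp_nat_mul, mul_comm (Real.exp ((S'.card : ℝ) * _)), mul_left_comm,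
            ← Real.exp_add]
          congr 2
          ring
      _ ≤ _ := by
          refine mul_le_mul_of_nonneg_left (Real.exp_le_exp.2 ?_) (by positivity)
          have : 6 * s / (16 * M) ≤ S'.card / (16 * M) := by gcongr
          linarith

/-- Vectors of `a`-digit numbers in base `b`. -/
def digitVectors (n b a : ℕ) : Finset (Fin n → ℕ) :=
  Fintype.piFinset fun _ => Finset.range (b ^ a)

theorem sum_digitVectors_succ {n b : ℕ} (hb : 0 < b) (a : ℕ) (V : (Fin n → ℕ) → ℝ) :
    ∑ y ∈ digitVectors n b (a + 1), V y
      = ∑ z ∈ digitVectors n b a, ∑ u : Fin n → Fin b, V (appendDigits z u) := by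
  rw [← Finset.sum_product']
  symm
  refine Finset.sum_nbij' (fun x => appendDigits x.1 x.2)
    (fun y => (fun i => y i / b, fun i => ⟨y i % b, Nat.mod_lt _ hb⟩)) ?_ ?_ ?_ ?_ ?_
  · rintro ⟨z, u⟩ h
    simp only [digitVectors, Finset.mem_product, Fintype.mem_piFinset, Finset.mem_range,
      Finset.mem_univ, and_true] at h ⊢
    intro i
    simp only [appendDigits]
    calc b * z i + u i < b * z i + b := by have := (u i).isLt; omega
      _ = b * (z i + 1) := by ring
      _ ≤ b * b ^ a := Nat.mul_le_mul_left _ (h i)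
      _ = _ := by ring
  · intro y h
    simp only [digitVectors, Finset.mem_product, Fintype.mem_piFinset, Finset.mem_range,
      Finset.mem_univ, and_true] at h ⊢
    intro i
    rw [Nat.div_lt_iff_lt_mul hb, ← pow_succ]
    exact h i
  · rintro ⟨z, u⟩ _
    refine Prod.ext (funext fun i => appendDigits_div z u i) (funext fun i => Fin.ext ?_)
    simp [appendDigits, Nat.mod_eq_of_lt]
  · intro y _
    funext i
    simp [appendDigits, Nat.div_add_mod]
  · intro x _
    rfl

theorem avg_failBound_le {n : ℕ} {Ω : Type*} {rel : Fin n → Fin n → Prop}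
    (hrel : ∀ i, ¬ rel i i) {f : Fin n → Ω} {X : Finset (Fin n)} {t t' s : ℝ} {M : ℕ}
    (hM : 0 < M) (ht' : 0 < t') (htt : 2 * t' / M ≤ t) (L : ℕ)
    [DecidablePred fun z : Fin n → ℕ =>
      ¬ HasMatching (SparsePair rel (fun i => (f i, z i)) X t') (8 * s)]
    (a : ℕ) :
    (∑ z ∈ digitVectors n (2 * M) a,
        failBound s ((L - a) * (6 * s / (16 * M))) (CertPair rel f X t z)) /
          (((2 * M : ℕ) : ℝ) ^ a) ^ n
      ≤ Real.exp (s - L * (6 * s / (16 * M))) + ∑ a' ∈ Finset.range a,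
        (((digitVectors n (2 * M) a').filter fun z =>
          ¬ HasMatching (SparsePair rel (fun i => (f i, z i)) X t') (8 * s)).card : ℝ) /
            (((2 * M : ℕ) : ℝ) ^ a') ^ n := by
  have hb : 0 < 2 * M := by omega
  have hb' : (0 : ℝ) < ((2 * M : ℕ) : ℝ) := by exact_mod_cast hb
  induction a with
  | zero =>
    have hcard : (digitVectors n (2 * M) 0).card = 1 := by simp [digitVectors]
    have := Finset.sum_le_card_nsmul (digitVectors n (2 * M) 0)
      (fun z => failBound s ((L - (0 : ℕ)) * (6 * s / (16 * M))) (CertPair rel f X t z))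
      (Real.exp (s - L * (6 * s / (16 * M)))) (fun z _ => (failBound_le_exp _ _ _).trans
        (Real.exp_le_exp.2 (by
          have : (0 : ℝ) ≤ matchNum (CertPair rel f X t z) := by positivity
          push_cast
          linarith)))
    rw [hcard, one_smul] at this
    simpa using this
  | succ a ih =>
    rw [Finset.sum_range_succ, ← add_assoc]
    refine le_trans ?_ (add_le_add_left ih _)
    rw [sum_digitVectors_succ hb, ← add_div, div_le_div_iff₀ (by positivity) (by positivity)]
    have key : ∀ z : Fin n → ℕ, ∑ u : Fin n → Fin (2 * M),
        failBound s ((L - (a + 1 : ℕ)) * (6 * s / (16 * M))) (CertPair rel f X t (appendDigits z u))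
        ≤ ((2 * M : ℕ) : ℝ) ^ n * (failBound s ((L - a) * (6 * s / (16 * M))) (CertPair rel f X t z)
          + if ¬ HasMatching (SparsePair rel (fun i => (f i, z i)) X t') (8 * s)
            then 1 else 0) := by
      intro z
      have hc : (Fintype.card (Fin n → Fin (2 * M)) : ℝ) = ((2 * M : ℕ) : ℝ) ^ n := by simp
      by_cases hok : HasMatching (SparsePair rel (fun i => (f i, z i)) X t') (8 * s)
      · have := sum_failBound_le hrel hM ht' htt hok ((L - (a + 1 : ℕ)) * (6 * s / (16 * M)))
        rw [hc] at this
        refine this.trans (le_of_eq ?_)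
        rw [if_neg (not_not.2 hok), add_zero]
        congr 2
        push_cast
        ring
      · rw [if_pos hok, ← hc]
        calc _ ≤ ∑ u : Fin n → Fin (2 * M), (1 : ℝ) :=
              Finset.sum_le_sum fun u _ => failBound_le_one _ _ _
          _ = (Fintype.card (Fin n → Fin (2 * M)) : ℝ) * 1 := by simp
          _ ≤ _ := mul_le_mul_of_nonneg_left
              (le_add_of_nonneg_left (failBound_nonneg _ _ _)) (by positivity)
    calc _ ≤ (∑ z ∈ digitVectors n (2 * M) a, ((2 * M : ℕ) : ℝ) ^ n *
          (failBound s ((L - a) * (6 * s / (16 * M))) (CertPair rel f X t z)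
          + if ¬ HasMatching (SparsePair rel (fun i => (f i, z i)) X t') (8 * s)
            then 1 else 0)) * (((2 * M : ℕ) : ℝ) ^ a) ^ n :=
          mul_le_mul_of_nonneg_right (Finset.sum_le_sum fun z _ => key z) (by positivity)
      _ = _ := by
          rw [← Finset.mul_sum, Finset.sum_add_distrib, Finset.sum_boole, pow_succ, mul_pow]
          ring

theorem card_fail_le {n : ℕ} {Ω : Type*} {rel : Fin n → Fin n → Prop}
    (hrel : ∀ i, ¬ rel i i) {f : Fin n → Ω} {X : Finset (Fin n)} {t t' s : ℝ} {M : ℕ}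
    (hM : 0 < M) (ht' : 0 < t') (htt : 2 * t' / M ≤ t) (L : ℕ)
    [DecidablePred fun z : Fin n → ℕ =>
      ¬ HasMatching (SparsePair rel (fun i => (f i, z i)) X t') (8 * s)]
    [DecidablePred fun z : Fin n → ℕ => ¬ HasMatching (CertPair rel f X t z) s] :
    (((digitVectors n (2 * M) L).filter fun z => ¬ HasMatching (CertPair rel f X t z) s).card : ℝ) /
        (((2 * M : ℕ) : ℝ) ^ L) ^ n
      ≤ Real.exp (s - L * (6 * s / (16 * M))) + ∑ a ∈ Finset.range L,
        (((digitVectors n (2 * M) a).filter fun z =>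
          ¬ HasMatching (SparsePair rel (fun i => (f i, z i)) X t') (8 * s)).card : ℝ) /
            (((2 * M : ℕ) : ℝ) ^ a) ^ n := by
  refine le_trans ?_ (avg_failBound_le hrel hM ht' htt L L)
  refine div_le_div_of_nonneg_right ?_ (by positivity)
  rw [← Finset.sum_boole]
  refine Finset.sum_le_sum fun z _ => ?_
  split_ifs with h
  · exact failBound_nonneg _ _ _
  · have hlt : ¬ s ≤ matchNum (CertPair rel f X t z) := by
      intro hs
      obtain ⟨S, hS1, hS2, hS3⟩ := exists_card_eq_matchNum (CertPair rel f X t z)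
      exact h ⟨S, by rwa [hS1], hS2, hS3⟩
    have h1 : (matchNum (CertPair rel f X t z) : ℝ) ≤ s := (not_le.1 hlt).le
    simpa [failBound, hlt] using h1

/-- The uniform distribution on `[0,1]^n`. -/
noncomputable def unifVec (n : ℕ) : Measure (Fin n → ℝ) :=
  Measure.pi fun _ => volume.restrict (Set.Icc (0 : ℝ) 1)

instance : IsProbabilityMeasure (volume.restrict (Set.Icc (0 : ℝ) 1)) := ⟨by simp⟩

instance (n : ℕ) : IsProbabilityMeasure (unifVec n) := by
  unfold unifVec
  infer_instance

instance (n d : ℕ) : IsProbabilityMeasure (unifCube n d) := by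
  unfold unifCube
  infer_instance

theorem unifVec_floor_le {n N : ℕ} (hN : 0 < N) (A : Finset (Fin n → ℕ)) :
    unifVec n {x | (fun i => ⌊(N : ℝ) * x i⌋₊) ∈ A}
      ≤ ENNReal.ofReal ((A.card : ℝ) / (N : ℝ) ^ n) := by
  have hN' : (0 : ℝ) < N := by exact_mod_cast hN
  have hone : ∀ y : ℕ, volume.restrict (Set.Icc (0 : ℝ) 1) {r | ⌊(N : ℝ) * r⌋₊ = y}
      ≤ ENNReal.ofReal (1 / N) := by
    intro y
    rw [Measure.restrict_apply₀' measurableSet_Icc.nullMeasurableSet]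
    calc _ ≤ volume (Set.Ico ((y : ℝ) / N) ((y + 1) / N)) := by
          refine measure_mono ?_
          rintro r ⟨hr, hr0, -⟩
          have hr : ⌊(N : ℝ) * r⌋₊ = y := hr
          obtain ⟨h1, h2⟩ := (Nat.floor_eq_iff (by positivity)).1 hr
          exact ⟨by rw [div_le_iff₀ hN']; linarith, by rw [lt_div_iff₀ hN']; linarith⟩
      _ = _ := by
          rw [Real.volume_Ico]
          congr 1
          ring
  have hset : {x : Fin n → ℝ | (fun i => ⌊(N : ℝ) * x i⌋₊) ∈ A}
      = ⋃ y ∈ A, Set.univ.pi fun i => {r : ℝ | ⌊(N : ℝ) * r⌋₊ = y i} := by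
    ext x
    simp only [Set.mem_ofPred_eq, Set.mem_iUnion, Set.mem_univ_pi, exists_prop]
    constructor
    · intro h
      exact ⟨_, h, fun i => rfl⟩
    · rintro ⟨y, hy, h⟩
      rwa [funext h]
  rw [hset]
  calc _ ≤ ∑ y ∈ A, unifVec n (Set.univ.pi fun i => {r : ℝ | ⌊(N : ℝ) * r⌋₊ = y i}) :=
        measure_biUnion_finset_le _ _
    _ ≤ ∑ y ∈ A, ENNReal.ofReal ((1 / N) ^ n) := by
        refine Finset.sum_le_sum fun y _ => ?_
        rw [unifVec, Measure.pi_pi]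
        calc _ ≤ ∏ i : Fin n, ENNReal.ofReal (1 / N) := Finset.prod_le_prod' fun i _ => hone _
          _ = _ := by rw [ENNReal.ofReal_pow (by positivity)]; simp
    _ = _ := by
        rw [Finset.sum_const, nsmul_eq_mul, ← ENNReal.ofReal_natCast,
          ← ENNReal.ofReal_mul (by positivity)]
        congr 1
        rw [one_div, inv_pow, div_eq_mul_inv]

theorem ae_unifVec_mem (n : ℕ) : ∀ᵐ x ∂unifVec n, ∀ i, 0 ≤ x i ∧ x i < 1 := by
  rw [ae_all_iff]
  intro i
  have h : ∀ᵐ r ∂(volume.restrict (Set.Icc (0 : ℝ) 1)), 0 ≤ r ∧ r < 1 := by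
    rw [← restrict_Ico_eq_restrict_Icc]
    exact ae_restrict_mem measurableSet_Ico
  exact (Measure.quasiMeasurePreserving_eval
    (fun _ : Fin n => volume.restrict (Set.Icc (0 : ℝ) 1)) i).ae h

theorem ae_unifVec_injective (n : ℕ) : ∀ᵐ x ∂unifVec n, Function.Injective x := by
  have h : ∀ᵐ x ∂unifVec n, ∀ i j, i ≠ j → x i ≠ x j := by
    rw [ae_all_iff]
    intro i
    rw [ae_all_iff]
    intro j
    by_cases hij : i = j
    · simp [hij]
    have hac : unifVec n ≪ (volume : Measure (Fin n → ℝ)) := by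
      rw [unifVec, ← Measure.restrict_pi_pi]
      exact Measure.absolutelyContinuous_of_le Measure.restrict_le_self
    refine hac.ae_le ?_
    let E : Submodule ℝ (Fin n → ℝ) :=
      LinearMap.ker (LinearMap.proj (R := ℝ) (φ := fun _ : Fin n => ℝ) i - LinearMap.proj j)
    have hE : E ≠ ⊤ := by
      intro htop
      have : (Pi.single i (1 : ℝ) : Fin n → ℝ) ∈ E := htop ▸ Submodule.mem_top
      simp [E, Ne.symm hij] at this
    have h0 := Measure.addHaar_submodule (volume : Measure (Fin n → ℝ)) E hE
    refine measure_mono_null ?_ h0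
    intro x hx
    have hx : ¬ (i ≠ j → x i ≠ x j) := hx
    push Not at hx
    obtain ⟨-, hx⟩ := hx
    simp [E, hx]
  filter_upwards [h] with x hx i j hij
  by_contra hne
  exact hx i j hne hij

theorem unifVec_not_hasMatching_le {n : ℕ} {Ω : Type*} {rel : Fin n → Fin n → Prop}
    (hrel : ∀ i, ¬ rel i i) {f : Fin n → Ω} {X : Finset (Fin n)} {t t' s : ℝ} {M : ℕ}
    (hM : 0 < M) (ht' : 0 < t') (htt : 2 * t' / M ≤ t) (L : ℕ)
    [DecidablePred fun z : Fin n → ℕ =>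
      ¬ HasMatching (SparsePair rel (fun i => (f i, z i)) X t') (8 * s)] :
    unifVec n {x | ¬ HasMatching (SparsePair (fun i j => x i < x j ∧ rel i j) f X t) s}
      ≤ ENNReal.ofReal (Real.exp (s - L * (6 * s / (16 * M))) + ∑ a ∈ Finset.range L,
        (((digitVectors n (2 * M) a).filter fun z =>
          ¬ HasMatching (SparsePair rel (fun i => (f i, z i)) X t') (8 * s)).card : ℝ) /
            (((2 * M : ℕ) : ℝ) ^ a) ^ n) := by
  classical
  set A := (digitVectors n (2 * M) L).filter fun z => ¬ HasMatching (CertPair rel f X t z) s with hA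
  have hN : 0 < (2 * M) ^ L := by positivity
  have hle := card_fail_le hrel hM ht' htt L (f := f) (X := X) (s := s)
  refine le_trans ?_ (ENNReal.ofReal_le_ofReal hle)
  have hfl := unifVec_floor_le hN A
  rw [Nat.cast_pow] at hfl
  refine le_trans (measure_mono_ae ?_) hfl
  filter_upwards [ae_unifVec_mem n] with x hx hbad
  have hN' : (0 : ℝ) < ((2 * M : ℕ) : ℝ) ^ L := by exact_mod_cast hN
  refine Finset.mem_filter.2 ⟨?_, ?_⟩
  · simp only [digitVectors, Fintype.mem_piFinset, Finset.mem_range]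
    intro i
    rw [Nat.floor_lt (mul_nonneg hN'.le (hx i).1)]
    push_cast at hN' ⊢
    nlinarith [(hx i).2]
  · rintro ⟨S, hS1, hS2, hS3⟩
    have hmono : ∀ m l, x m ≤ x l → ⌊((2 * M : ℕ) : ℝ) ^ L * x m⌋₊
        ≤ ⌊((2 * M : ℕ) : ℝ) ^ L * x l⌋₊ :=
      fun m l h => Nat.floor_le_floor (mul_le_mul_of_nonneg_left h hN'.le)
    refine hbad ⟨S, hS1, hS2, fun a ha => ?_⟩
    obtain ⟨h1, h2, h3, h4, h5, h6⟩ := hS3 a ha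
    refine ⟨h1, h2, h3, ⟨?_, h5⟩, lt_of_le_of_lt
      (Nat.cast_le.2 (Set.ncard_le_ncard ?_ (Set.toFinite _))) h6⟩
    · by_contra hcon
      exact absurd (hmono _ _ (not_lt.1 hcon)) (not_le.2 h4)
    · rintro ℓ ⟨a1, a2, ⟨a3, a4⟩, a5, a6⟩
      exact ⟨a1, a2, hmono _ _ a3.le, hmono _ _ a5.le, a4, a6⟩

theorem measurable_strictDom (n d : ℕ) :
    Measurable fun (p : Fin n → Fin d → ℝ) (i j : Fin n) => strictDom (p i) (p j) := by
  refine measurable_pi_iff.2 fun i => measurable_pi_iff.2 fun j => ?_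
  refine measurable_to_prop ?_
  have : (fun p : Fin n → Fin d → ℝ => strictDom (p i) (p j)) ⁻¹' {True}
      = ⋂ k, {p : Fin n → Fin d → ℝ | p i k < p j k} := by
    ext p
    simp [strictDom]
  rw [this]
  exact MeasurableSet.iInter fun k => measurableSet_lt (by fun_prop) (by fun_prop)

theorem measurable_lt_and_strictDom (n d : ℕ) :
    Measurable fun (q : (Fin n → ℝ) × (Fin n → Fin d → ℝ)) (i j : Fin n) =>
      q.1 i < q.1 j ∧ strictDom (q.2 i) (q.2 j) := by
  refine measurable_pi_iff.2 fun i => measurable_pi_iff.2 fun j => ?_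
  have h1 : MeasurableSet {q : (Fin n → ℝ) × (Fin n → Fin d → ℝ) | q.1 i < q.1 j} :=
    measurableSet_lt (by fun_prop) (by fun_prop)
  have hsnd : Measurable (Prod.snd : (Fin n → ℝ) × (Fin n → Fin d → ℝ) → _) := measurable_snd
  have h2 := (measurable_pi_apply j).comp
    ((measurable_pi_apply i).comp ((measurable_strictDom n d).comp
      hsnd))
  exact (measurableSet_setOfPred.1 h1).and h2

theorem measurePreserving_split (n d : ℕ) :
    MeasurePreserving (fun p : Fin n → Fin (d + 1) → ℝ =>
      ((fun i => p i 0, fun i k => p i k.succ) : (Fin n → ℝ) × (Fin n → Fin d → ℝ)))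
      (unifCube n (d + 1)) ((unifVec n).prod (unifCube n d)) := by
  have h1 := measurePreserving_pi (ι := Fin n) (fun _ => _) (fun _ => _) fun _ =>
    measurePreserving_piFinSuccAbove
      (fun _ : Fin (d + 1) => volume.restrict (Set.Icc (0 : ℝ) 1)) 0
  exact (measurePreserving_arrowProdEquivProdArrow ℝ (Fin d → ℝ) (Fin n)
    (fun _ => volume.restrict (Set.Icc (0 : ℝ) 1))
    (fun _ => Measure.pi fun _ => volume.restrict (Set.Icc (0 : ℝ) 1))).comp h1

theorem unifCube_succ_apply (n d : ℕ) (Φ : (Fin n → Fin n → Prop) → Prop) :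
    unifCube n (d + 1) {p | Φ fun i j => strictDom (p i) (p j)}
      = ∫⁻ r, unifVec n {x | Φ fun i j => x i < x j ∧ strictDom (r i) (r j)} ∂unifCube n d := by
  have hS : MeasurableSet {q : (Fin n → ℝ) × (Fin n → Fin d → ℝ) |
      Φ fun i j => q.1 i < q.1 j ∧ strictDom (q.2 i) (q.2 j)} :=
    measurable_lt_and_strictDom n d (Set.toFinite {R | Φ R}).measurableSet
  have h := (measurePreserving_split n d).measure_preimage hS.nullMeasurableSet
  rw [Measure.prod_apply_symm hS] at h
  refine Eq.trans (congrArg _ ?_) h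
  ext p
  have hp : (fun i j => strictDom (p i) (p j)) = fun i j => p i 0 < p j 0 ∧
      strictDom (fun k => p i k.succ) (fun k => p j k.succ) := by
    funext i j
    exact propext Fin.forall_fin_succ
  exact iff_of_eq (congrArg Φ hp)

theorem lintegral_card_filter_div_le {α β : Type*} [MeasurableSpace α] {μ : Measure α}
    (D : Finset β) (hD : 0 < D.card) (B : α → β → Prop) [∀ r, DecidablePred (B r)]
    (hB : ∀ z, MeasurableSet {r | B r z}) {ε : ENNReal} (h : ∀ z ∈ D, μ {r | B r z} ≤ ε) :
    ∫⁻ r, ENNReal.ofReal (((D.filter (B r)).card : ℝ) / D.card) ∂μ ≤ ε := by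
  have hD' : (0 : ℝ) < D.card := by exact_mod_cast hD
  calc _ = ∫⁻ r, (∑ z ∈ D, {r | B r z}.indicator 1 r) * (D.card : ENNReal)⁻¹ ∂μ := by
        refine lintegral_congr fun r => ?_
        rw [ENNReal.ofReal_div_of_pos hD', div_eq_mul_inv, ENNReal.ofReal_natCast,
          ENNReal.ofReal_natCast, Finset.card_filter]
        simp [Set.indicator_apply]
    _ = (∑ z ∈ D, μ {r | B r z}) * (D.card : ENNReal)⁻¹ := by
        rw [lintegral_mul_const _ (Finset.measurable_sum _ fun z _ =>
          measurable_one.indicator (hB z)), lintegral_finsetSum _ fun z _ =>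
          measurable_one.indicator (hB z)]
        simp_rw [lintegral_indicator_one (hB _)]
    _ ≤ (∑ z ∈ D, ε) * (D.card : ENNReal)⁻¹ := by gcongr with z hz; exact h z hz
    _ = ε := by
        rw [Finset.sum_const, nsmul_eq_mul, mul_comm, ← mul_assoc, ENNReal.inv_mul_cancel, one_mul]
        · exact_mod_cast hD.ne'
        · simp

theorem card_digitVectors (n b a : ℕ) : (digitVectors n b a).card = (b ^ a) ^ n := by
  simp [digitVectors]

theorem unifCube_succ_not_hasMatching_le {n d : ℕ} (hd : 0 < d) {Ω : Type*} {f : Fin n → Ω}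
    {X : Finset (Fin n)} {t t' s ε : ℝ} {M : ℕ}
    (hM : 0 < M) (ht' : 0 < t') (htt : 2 * t' / M ≤ t) (hε : 0 ≤ ε) (L : ℕ)
    (h : ∀ a < L, ∀ z ∈ digitVectors n (2 * M) a, unifCube n d {r | ¬ HasMatching
      (SparsePair (fun i j => strictDom (r i) (r j)) (fun i => (f i, z i)) X t') (8 * s)}
        ≤ ENNReal.ofReal ε) :
    unifCube n (d + 1) {p | ¬ HasMatching
      (SparsePair (fun i j => strictDom (p i) (p j)) f X t) s}
        ≤ ENNReal.ofReal (Real.exp (s - L * (6 * s / (16 * M))) + L * ε) := by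
  classical
  have hpos : ∀ a, 0 < (digitVectors n (2 * M) a).card := fun a => by
    rw [card_digitVectors]
    positivity
  rw [unifCube_succ_apply n d fun R => ¬ HasMatching (SparsePair R f X t) s]
  have hmeas : ∀ z : Fin n → ℕ, MeasurableSet {r : Fin n → Fin d → ℝ | ¬ HasMatching
      (SparsePair (fun i j => strictDom (r i) (r j)) (fun i => (f i, z i)) X t') (8 * s)} :=
    fun z => measurable_strictDom n d (Set.toFinite {R | ¬ HasMatching
      (SparsePair R (fun i => (f i, z i)) X t') (8 * s)}).measurableSet
  have hmeas' : ∀ a, Measurable fun r : Fin n → Fin d → ℝ => ENNReal.ofReal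
      ((((digitVectors n (2 * M) a).filter fun z => ¬ HasMatching (SparsePair
        (fun i j => strictDom (r i) (r j)) (fun i => (f i, z i)) X t') (8 * s)).card : ℝ) /
          (digitVectors n (2 * M) a).card) := fun a =>
    (measurable_of_finite fun R : Fin n → Fin n → Prop => ENNReal.ofReal
      ((((digitVectors n (2 * M) a).filter fun z => ¬ HasMatching (SparsePair
        R (fun i => (f i, z i)) X t') (8 * s)).card : ℝ) /
          (digitVectors n (2 * M) a).card)).comp (measurable_strictDom n d)
  calc _ ≤ ∫⁻ r, (ENNReal.ofReal (Real.exp (s - L * (6 * s / (16 * M))))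
          + ∑ a ∈ Finset.range L, ENNReal.ofReal
      ((((digitVectors n (2 * M) a).filter fun z => ¬ HasMatching (SparsePair
        (fun i j => strictDom (r i) (r j)) (fun i => (f i, z i)) X t') (8 * s)).card : ℝ) /
          (digitVectors n (2 * M) a).card)) ∂unifCube n d := by
        refine lintegral_mono fun r => ?_
        have hr : ∀ i, ¬ strictDom (r i) (r i) := fun i hi => lt_irrefl _ (hi ⟨0, hd⟩)
        refine (unifVec_not_hasMatching_le hr hM ht' htt L).trans ?_
        rw [ENNReal.ofReal_add (by positivity) (Finset.sum_nonneg fun a _ => by positivity),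
          ENNReal.ofReal_sum_of_nonneg fun a _ => by positivity]
        simp only [card_digitVectors, Nat.cast_pow]
        exact le_rfl
    _ ≤ ENNReal.ofReal (Real.exp (s - L * (6 * s / (16 * M))))
          + ∑ a ∈ Finset.range L, ENNReal.ofReal ε := by
        rw [lintegral_add_left measurable_const, lintegral_finsetSum _ fun a _ => hmeas' a]
        refine add_le_add (by simp) (Finset.sum_le_sum fun a ha => ?_)
        exact lintegral_card_filter_div_le _ (hpos a) _ hmeas (h a (Finset.mem_range.1 ha))
    _ = _ := by
        rw [Finset.sum_const, Finset.card_range, nsmul_eq_mul,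
          ENNReal.ofReal_add (by positivity) (by positivity), ENNReal.ofReal_mul (by positivity),
          ENNReal.ofReal_natCast]

theorem exp_add_mul_exp_le {L : ℕ} {w : ℝ} (hw : (L : ℝ) ≤ w) :
    Real.exp (-(2 * w)) + L * Real.exp (-(17 * w)) ≤ Real.exp (-w) := by
  have hL : (0 : ℝ) ≤ L := by positivity
  have h1 : Real.exp (-(17 * w)) ≤ Real.exp (-(2 * w)) := Real.exp_le_exp.2 (by linarith)
  have h2 : (1 : ℝ) + L ≤ Real.exp w := by linarith [Real.add_one_le_exp w]
  calc _ ≤ Real.exp (-(2 * w)) + L * Real.exp (-(2 * w)) := by gcongr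
    _ = (1 + L) * Real.exp (-(2 * w)) := by ring
    _ ≤ Real.exp w * Real.exp (-(2 * w)) := by gcongr
    _ = _ := by
        rw [← Real.exp_add]
        congr 1
        ring

theorem card_image_prodMk_le {ι Ω : Type*} [DecidableEq Ω] (f : ι → Ω) (z : ι → ℕ)
    (X : Finset ι) (N : ℕ) (hz : ∀ i, z i < N) :
    (X.image fun i => (f i, z i)).card ≤ (X.image f).card * N := by
  have : (X.image fun i => (f i, z i)) ⊆ (X.image f) ×ˢ Finset.range N := by
    intro a ha
    obtain ⟨i, hi, rfl⟩ := Finset.mem_image.1 ha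
    exact Finset.mem_product.2 ⟨Finset.mem_image_of_mem f hi, Finset.mem_range.2 (hz i)⟩
  simpa using Finset.card_le_card this

theorem unifCube_one_not_hasMatching {n : ℕ} {Ω : Type*} [DecidableEq Ω] (f : Fin n → Ω)
    (X : Finset (Fin n)) (hX : 0 < X.card) (hq : 4 * (X.image f).card ≤ X.card) :
    unifCube n 1 {p | ¬ HasMatching (SparsePair (fun i j => strictDom (p i) (p j)) f X
      (8 * n / X.card)) ((8 : ℝ)⁻¹ * X.card)} = 0 := by
  rw [unifCube_succ_apply n 0 fun R => ¬ HasMatching (SparsePair R f X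
    (8 * n / X.card)) ((8 : ℝ)⁻¹ * X.card)]
  refine (lintegral_congr fun r => ?_).trans lintegral_zero
  rw [← compl_mem_ae_iff]
  filter_upwards [ae_unifVec_injective n] with x hx hbad
  refine hbad ?_
  have : (fun i j => x i < x j ∧ strictDom (r i) (r j)) = fun i j => x i < x j := by
    simp [strictDom]
  rw [this]
  exact hasMatching_of_injective x hx f X hX hq

theorem unifCube_not_hasMatching_le {n k M L : ℕ} {T : ℝ} (hM : 0 < M) (hk : 0 < k) (hn : k ≤ n)
    (hT : 1 ≤ T) (hL : 8 * T * M ≤ L) (e : ℕ) :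
    (L : ℝ) ≤ (17 : ℝ)⁻¹ ^ (e + 1) * k → ∀ {Ω : Type} [DecidableEq Ω] (f : Fin n → Ω)
      (X : Finset (Fin n)), X.card = k →
      4 * (X.image f).card * ((2 * M) ^ (L - 1)) ^ e ≤ k →
      unifCube n (e + 1) {p | ¬ HasMatching (SparsePair (fun i j => strictDom (p i) (p j)) f X
          (8 * n / k * ((1 / 8 : ℝ) * M)⁻¹ ^ e)) ((8 : ℝ)⁻¹ ^ (e + 1) * k)}
        ≤ ENNReal.ofReal (Real.exp (-((17 : ℝ)⁻¹ ^ (e + 1) * k * T))) := by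
  have hk' : (0 : ℝ) < k := by exact_mod_cast hk
  have hM' : (0 : ℝ) < M := by exact_mod_cast hM
  have hn' : (0 : ℝ) < n := by exact_mod_cast hk.trans_le hn
  induction e with
  | zero =>
    intro _ Ω _ f X hX hq
    subst hX
    have := unifCube_one_not_hasMatching f X hk (by simpa using hq)
    simp only [zero_add, pow_one, pow_zero, mul_one]
    rw [this]
    exact zero_le
  | succ e ih =>
    intro hw Ω _ f X hX hq
    set s : ℝ := (8 : ℝ)⁻¹ ^ (e + 1 + 1) * k with hs
    set w : ℝ := (17 : ℝ)⁻¹ ^ (e + 1 + 1) * k * T with hwdef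
    have h8s : (8 : ℝ)⁻¹ ^ (e + 1) * k = 8 * s := by
      rw [hs, pow_succ _ (e + 1)]
      ring
    have h17w : (17 : ℝ)⁻¹ ^ (e + 1) * k * T = 17 * w := by
      rw [hwdef, pow_succ _ (e + 1)]
      ring
    have hw' : (L : ℝ) ≤ (17 : ℝ)⁻¹ ^ (e + 1) * k := by
      refine hw.trans (mul_le_mul_of_nonneg_right ?_ hk'.le)
      exact pow_le_pow_of_le_one (by norm_num) (by norm_num) (Nat.le_succ _)
    have hs0 : 0 < s := by positivity
    have ht' : 0 < 8 * n / k * ((1 / 8 : ℝ) * M)⁻¹ ^ e := by positivity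
    have htt : 2 * (8 * n / k * ((1 / 8 : ℝ) * M)⁻¹ ^ e) / M
        ≤ 8 * n / k * ((1 / 8 : ℝ) * M)⁻¹ ^ (e + 1) := by
      rw [pow_succ, ← mul_assoc (8 * (n : ℝ) / k)]
      generalize 8 * n / k * ((1 / 8 : ℝ) * M)⁻¹ ^ e = t' at ht'
      calc 2 * t' / M ≤ 8 * t' / M := by gcongr; norm_num
        _ = _ := by
          field_simp
    refine (unifCube_succ_not_hasMatching_le (Nat.succ_pos e) hM ht' htt
      (Real.exp_nonneg (-(17 * w))) L ?_).trans (ENNReal.ofReal_le_ofReal ?_)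
    · intro a ha z hz
      rw [← h8s, ← h17w]
      refine ih hw' _ X hX (le_trans ?_ hq)
      have hz' : ∀ i, z i < (2 * M) ^ a := fun i =>
        Finset.mem_range.1 (Fintype.mem_piFinset.1 hz i)
      have h1 := card_image_prodMk_le f z X _ hz'
      have h2 : (2 * M) ^ a ≤ (2 * M) ^ (L - 1) :=
        Nat.pow_le_pow_right (by omega) (by omega)
      calc _ ≤ 4 * ((X.image f).card * (2 * M) ^ (L - 1)) * ((2 * M) ^ (L - 1)) ^ e := by
            gcongr
            exact h1.trans (Nat.mul_le_mul_left _ h2)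
        _ = _ := by ring
    · refine le_trans (add_le_add_left (Real.exp_le_exp.2 ?_) _) (exp_add_mul_exp_le (w := w) ?_)
      · have h1 : 3 * (s * T) ≤ L * (6 * s / (16 * M)) := by
          have : 3 * (s * T) = 8 * T * M * (6 * s / (16 * M)) := by
            field_simp
            norm_num
          rw [this]
          gcongr
        have h2 : s ≤ s * T := le_mul_of_one_le_right hs0.le hT
        have h3 : w ≤ s * T := by
          rw [hwdef, hs]
          gcongr
          norm_num
        linarith
      · exact hw.trans (le_mul_of_one_le_right (by positivity) hT)

open scoped Asymptotics in
theorem eventually_log_bounds (d : ℕ) : ∀ᶠ k : ℕ in atTop,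
    1 ≤ Real.log (Real.log k) ∧
    8 * (d : ℝ) ^ 2 * Real.log (Real.log k) ≤ Real.sqrt (Real.log k) ∧
    Real.log k + 1 ≤ (17 : ℝ)⁻¹ ^ d * k := by
  have hk : Tendsto (fun k : ℕ => (k : ℝ)) atTop atTop := tendsto_natCast_atTop_atTop
  have hl := Real.tendsto_log_atTop.comp hk
  have h1 := (Real.tendsto_log_atTop.comp hl).eventually_ge_atTop 1
  have h2 := hl.eventually ((isLittleO_log_rpow_atTop (r := 1 / 2) (by norm_num)).bound
    (c := 1 / (8 * (d : ℝ) ^ 2 + 1)) (by positivity))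
  have h3 := hk.eventually ((Real.isLittleO_log_id_atTop.add
    (Asymptotics.isLittleO_const_left.2 (Or.inr tendsto_norm_atTop_atTop) :
      (fun _ : ℝ => (1 : ℝ)) =o[atTop] id)).bound (c := (17 : ℝ)⁻¹ ^ d) (by positivity))
  filter_upwards [h1, h2, h3] with k h1 h2 h3
  simp only [Function.comp_apply] at h1 h2
  refine ⟨h1, ?_, ?_⟩
  · rw [← Real.sqrt_eq_rpow, Real.norm_of_nonneg (by linarith),
      Real.norm_of_nonneg (Real.sqrt_nonneg _), div_mul_eq_mul_div, one_mul,
      le_div_iff₀ (by positivity)] at h2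
    nlinarith
  · refine (Real.le_norm_self _).trans (h3.trans_eq ?_)
    simp

theorem four_mul_card_mul_pow_le {k M L Q e : ℕ} {T : ℝ} (hk : 0 < k) (hM : 0 < M)
    (hML : 8 * ((e + 1 : ℕ) : ℝ) ^ 2 * T * M * Real.log (Real.log k) ≤ Real.log k)
    (h2M : 2 * (M : ℝ) ≤ Real.log k) (hL : ((L - 1 : ℕ) : ℝ) ≤ 8 * T * M)
    (hQ : (Q : ℝ) ≤ (k : ℝ) ^ ((1 : ℝ) / (e + 1 : ℕ)) / 4) :
    4 * Q * ((2 * M) ^ (L - 1)) ^ e ≤ k := by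
  have hk' : (0 : ℝ) < k := by exact_mod_cast hk
  have hM' : (0 : ℝ) < M := by exact_mod_cast hM
  have hd : (0 : ℝ) < ((e + 1 : ℕ) : ℝ) := by positivity
  set l := Real.log k with hl
  set d : ℝ := ((e + 1 : ℕ) : ℝ) with hddef
  have hl0 : 0 ≤ l := by linarith
  have hW : ((2 * M : ℕ) : ℝ) ^ (L - 1) ≤ Real.exp (l / d ^ 2) := by
    have h0 : (0 : ℝ) < ((2 * M : ℕ) : ℝ) := by positivity
    rw [← Real.log_le_iff_le_exp (by positivity), Real.log_pow, le_div_iff₀ (by positivity)]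
    have h1 : Real.log ((2 * M : ℕ) : ℝ) ≤ Real.log l :=
      Real.log_le_log h0 (by push_cast; exact h2M)
    calc _ ≤ (8 * T * M) * Real.log l * d ^ 2 := by
          gcongr
          exact le_trans (by positivity) hL
      _ = 8 * d ^ 2 * T * M * Real.log l := by ring
      _ ≤ l := hML
  have hk1 : (k : ℝ) ^ ((1 : ℝ) / d) = Real.exp (l / d) := by
    rw [Real.rpow_def_of_pos hk', mul_one_div]
  rw [hk1] at hQ
  have : (4 * Q * (((2 * M : ℕ) : ℝ) ^ (L - 1)) ^ e : ℝ) ≤ k := by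
    calc _ ≤ Real.exp (l / d) * (Real.exp (l / d ^ 2)) ^ e := by
          gcongr
          linarith
      _ = Real.exp (l / d + e * (l / d ^ 2)) := by rw [Real.exp_add, Real.exp_nat_mul]
      _ ≤ Real.exp l := by
          refine Real.exp_le_exp.2 ?_
          have he : (e : ℝ) = d - 1 := by rw [hddef]; push_cast; ring
          have : l / d + e * (l / d ^ 2) = l * ((2 * d - 1) / d ^ 2) := by
            rw [he]
            field_simp
            ring
          rw [this]
          refine mul_le_of_le_one_right hl0 ?_
          rw [div_le_one (by positivity)]
          nlinarith [sq_nonneg (d - 1)]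
      _ = k := Real.exp_log hk'
  exact_mod_cast this

theorem stmt_16 (dh : ℕ) (hdh : 1 ≤ dh) :
    ∃ k₀ : ℕ, ∀ k : ℕ, k₀ ≤ k → ∀ n : ℕ, k ≤ n →
    ∀ T : ℝ, 1 ≤ T → T ≤ Real.sqrt (Real.log k) →
    ∀ Q : ℕ, 1 ≤ Q → (Q : ℝ) ≤ (k : ℝ) ^ ((1 : ℝ) / dh) / 4 →
    ∀ (Ω : Type) (instΩ : Fintype Ω), @Fintype.card Ω instΩ = Q →
    ∀ f : Fin n → Ω, ∀ X : Finset (Fin n), X.card = k →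
    ENNReal.ofReal (1 - Real.exp (-((17 : ℝ)⁻¹ ^ dh * k * T)))
      ≤ unifCube n dh {p : Fin n → Fin dh → ℝ |
          ∃ 𝒳 : Finset (Fin n × Fin n),
            -- at least 8^{-d̂}·k pairs …
            (8 : ℝ)⁻¹ ^ dh * k ≤ (𝒳.card : ℝ) ∧
            -- … pairwise disjoint as two-element sets of indices …
            (∀ a ∈ 𝒳, ∀ b ∈ 𝒳, a ≠ b →
              a.1 ≠ b.1 ∧ a.1 ≠ b.2 ∧ a.2 ≠ b.1 ∧ a.2 ≠ b.2) ∧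
            -- … each pair consisting of marked indices on the same level, with
            -- p_i ≺ p_j and few unmarked same-level points in between
            ∀ a ∈ 𝒳, a.1 ∈ X ∧ a.2 ∈ X ∧ f a.1 = f a.2 ∧
              strictDom (p a.1) (p a.2) ∧
              (({ℓ : Fin n | ℓ ∉ X ∧ f ℓ = f a.1 ∧ strictDom (p a.1) (p ℓ) ∧
                  strictDom (p ℓ) (p a.2)}).ncard : ℝ)
                < (8 * n / k) *
                    ((1 / 8 : ℝ) *
                      (⌊Real.log k / (8 * dh ^ 2 * T * Real.log (Real.log k))⌋₊ : ℝ))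
                      ^ (1 - (dh : ℤ))} := by
  obtain ⟨e, rfl⟩ : ∃ e, dh = e + 1 := ⟨dh - 1, by omega⟩
  obtain ⟨k₀, hk₀⟩ := eventually_atTop.1 (eventually_log_bounds (e + 1))
  refine ⟨max k₀ 1, fun k hk n hn T hT1 hT2 Q hQ1 hQ2 Ω instΩ hΩ f X hX => ?_⟩
  classical
  obtain ⟨hlog, hsqrt, hlin⟩ := hk₀ k (le_of_max_le_left hk)
  have hkpos : 0 < k := le_of_max_le_right hk
  have hT0 : 0 < T := by linarith
  set l := Real.log k with hl
  have hd1 : (1 : ℝ) ≤ ((e + 1 : ℕ) : ℝ) ^ 2 :=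
    one_le_pow₀ (by push_cast; linarith [e.cast_nonneg (α := ℝ)])
  have hsq : 0 < Real.sqrt l := by nlinarith
  have hl0 : 0 < l := Real.sqrt_pos.1 hsq
  set D : ℝ := 8 * ((e + 1 : ℕ) : ℝ) ^ 2 * T * Real.log l with hD
  have hD0 : 0 < D := by positivity
  have hDl : D ≤ l := by
    calc D = 8 * ((e + 1 : ℕ) : ℝ) ^ 2 * Real.log l * T := by rw [hD]; ring
      _ ≤ Real.sqrt l * Real.sqrt l := by gcongr
      _ = l := Real.mul_self_sqrt hl0.le
  set M := ⌊l / D⌋₊ with hM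
  have hM0 : 0 < M := Nat.floor_pos.2 ((one_le_div hD0).2 hDl)
  have hMD : (M : ℝ) * D ≤ l := (le_div_iff₀ hD0).1 (Nat.floor_le (by positivity))
  have hM0' : (0 : ℝ) < M := by exact_mod_cast hM0
  have hTM : 8 * T * M ≤ M * D := by
    have h1 : T ≤ ((e + 1 : ℕ) : ℝ) ^ 2 * T * Real.log l := by
      calc T = 1 * T * 1 := by ring
        _ ≤ _ := by gcongr
    rw [hD]
    nlinarith
  have h2M : 2 * (M : ℝ) ≤ l := by nlinarith
  set L := ⌈8 * T * M⌉₊ with hL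
  have hLlt : (L : ℝ) < 8 * T * M + 1 := Nat.ceil_lt_add_one (by positivity)
  have hL1 : 1 ≤ L := Nat.ceil_pos.2 (by positivity)
  have hL' : ((L - 1 : ℕ) : ℝ) ≤ 8 * T * M := by
    rw [Nat.cast_sub hL1]
    push_cast
    linarith
  have hQ := four_mul_card_mul_pow_le (L := L) hkpos hM0
    (by rw [← hl]; calc _ = M * D := by rw [hD]; ring
      _ ≤ l := hMD) h2M hL' hQ2
  have hcard : (X.image f).card ≤ Q := hΩ ▸ Finset.card_le_univ _
  have hmain := unifCube_not_hasMatching_le hM0 hkpos hn hT1 (Nat.le_ceil (8 * T * M)) e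
    (by linarith) f X hX (le_trans (by gcongr) hQ)
  have hexp : (8 * (n : ℝ) / k) * ((1 / 8 : ℝ) * (M : ℝ)) ^ (1 - ((e + 1 : ℕ) : ℤ))
      = 8 * n / k * ((1 / 8 : ℝ) * M)⁻¹ ^ e := by
    have : (1 - ((e + 1 : ℕ) : ℤ)) = -(e : ℤ) := by push_cast; ring
    rw [this, zpow_neg, zpow_natCast, inv_pow]
  rw [hexp, ENNReal.ofReal_sub _ (Real.exp_nonneg _), ENNReal.ofReal_one, tsub_le_iff_right]
  have hone : (1 : ENNReal) = unifCube n (e + 1) Set.univ := measure_univ.symm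
  rw [hone, ← Set.union_compl_self {p : Fin n → Fin (e + 1) → ℝ | HasMatching
    (SparsePair (fun i j => strictDom (p i) (p j)) f X (8 * n / k * ((1 / 8 : ℝ) * M)⁻¹ ^ e))
      ((8 : ℝ)⁻¹ ^ (e + 1) * k)}]
  exact (measure_union_le _ _).trans (add_le_add_right hmain _)
end

section
/- Fix an integer d ≥ 2. There exists a constant C = C(d) > 0 such that if p_1,…,p_n are independent uniformly random points in [0,1]^d and N denotes the number of indices i ∈ {1,…,n} such that no j ≠ i satisfies p_j ∈ R[0, p_i] (where R[0, p_i] is the open box ∏_{k=1}^d (0, (p_i)_k)), then n^{3/2} · Pr[ N > C·(log n)^{d−1} ] → 0 as n → ∞. -/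
open MeasureTheory Filter

/-- The half-open dyadic box of points `x` with `2 ^ (-(k j + 1)) < x j ≤ 2 ^ (-k j)`. -/
def dyadicCell {d : ℕ} (k : Fin d → ℕ) : Set (Fin d → ℝ) :=
  Set.univ.pi fun j => Set.Ioc ((1 / 2 : ℝ) ^ (k j + 1)) ((1 / 2) ^ k j)

/-- The orthant of points `x` with `x j ≤ 2 ^ (-k j)`. -/
def dyadicCorner {d : ℕ} (k : Fin d → ℕ) : Set (Fin d → ℝ) :=
  Set.univ.pi fun j => Set.Iic ((1 / 2 : ℝ) ^ k j)

/-- The multi-indices of total weight at most `M`. -/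
def dyadicIndices (d M : ℕ) : Finset (Fin d → ℕ) :=
  (Finset.range (M + 1)).biUnion fun m => Finset.univ.piAntidiag m

/-- The points lying in some corner of total weight `M + 1`. -/
def deepRegion (d M : ℕ) : Set (Fin d → ℝ) :=
  ⋃ k ∈ Finset.univ.piAntidiag (M + 1), dyadicCorner k

/-- The uniform distribution on `[0,1]^d`. -/
noncomputable def cubeMeasure (d : ℕ) : Measure (Fin d → ℝ) :=
  Measure.pi fun _ => volume.restrict (Set.Icc (0 : ℝ) 1)

/-- The indices of the points whose open box towards the origin contains no other point. -/
def minimalIndices {n d : ℕ} (p : Fin n → Fin d → ℝ) : Set (Fin n) :=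
  {i | ∀ j, j ≠ i → ¬ ∀ k, 0 < p j k ∧ p j k < p i k}

/-- A weight that is at least `0` on `E`, `1` off `E`, and `1 + δ` on `(G ∪ D) \ E`. -/
noncomputable def cellWeight {X : Type*} (δ : ℝ) (E G D : Set X) (x : X) : ℝ :=
  1 - E.indicator 1 x + δ * (G.indicator 1 x + D.indicator 1 x)

instance (d : ℕ) : IsProbabilityMeasure (cubeMeasure d) := by
  unfold cubeMeasure; infer_instance

instance inst_s19 (n d : ℕ) : IsProbabilityMeasure (unifCube n d) := by
  unfold unifCube; infer_instance

theorem unifCube_eq_pi (n d : ℕ) : unifCube n d = Measure.pi fun _ => cubeMeasure d := rfl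

theorem ae_mem_cube (n d : ℕ) :
    ∀ᵐ p ∂unifCube n d, ∀ i j, p i j ∈ Set.Icc (0 : ℝ) 1 := by
  have h1 : ∀ᵐ x ∂cubeMeasure d, ∀ j, x j ∈ Set.Icc (0 : ℝ) 1 :=
    ae_all_iff.2 fun j => (Measure.quasiMeasurePreserving_eval
      (fun _ : Fin d => volume.restrict (Set.Icc (0 : ℝ) 1)) j).ae
      (ae_restrict_mem measurableSet_Icc)
  exact ae_all_iff.2 fun i =>
    (Measure.quasiMeasurePreserving_eval (fun _ : Fin n => cubeMeasure d) i).ae h1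

theorem card_piAntidiag_le (d m : ℕ) :
    (Finset.univ.piAntidiag m : Finset (Fin d → ℕ)).card ≤ (m + 1) ^ (d - 1) := by
  obtain _ | e := d
  · simpa using Finset.card_le_one_of_subsingleton
      (Finset.univ.piAntidiag m : Finset (Fin 0 → ℕ))
  · have h := Finset.card_le_card_of_injOn (s := Finset.univ.piAntidiag m)
      (t := Fintype.piFinset fun _ : Fin e => Finset.range (m + 1))
      (fun k : Fin (e + 1) → ℕ => fun j : Fin e => k j.succ) ?_ ?_
    · simpa using h
    · intro k hk
      have hk : ∑ i, k i = m := by simpa using hk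
      simp only [Finset.mem_coe, Fintype.mem_piFinset, Finset.mem_range]
      intro j
      have := Finset.single_le_sum (f := k) (fun i _ => Nat.zero_le _) (Finset.mem_univ j.succ)
      omega
    · intro k hk l hl hkl
      have hk : ∑ i, k i = m := by simpa using hk
      have hl : ∑ i, l i = m := by simpa using hl
      have hs : ∀ j : Fin e, k j.succ = l j.succ := fun j => congrFun hkl j
      rw [Fin.sum_univ_succ] at hk hl
      simp only [hs] at hk
      funext j
      refine Fin.cases ?_ hs j
      omega

theorem mem_dyadicIndices {d M : ℕ} {k : Fin d → ℕ} :
    k ∈ dyadicIndices d M ↔ ∑ j, k j ≤ M := by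
  simp [dyadicIndices]

theorem exists_le_sum_eq {ι : Type*} [Fintype ι] (k : ι → ℕ) {m : ℕ} (hm : m ≤ ∑ j, k j) :
    ∃ l ≤ k, ∑ j, l j = m := by
  classical
  induction m with
  | zero => exact ⟨0, fun _ => Nat.zero_le _, by simp⟩
  | succ m ih =>
    obtain ⟨l, hl, hs⟩ := ih (by omega)
    obtain ⟨j, -, hj⟩ := Finset.exists_lt_of_sum_lt (s := Finset.univ) (f := l) (g := k)
      (by omega)
    refine ⟨l + Pi.single j 1, fun i => ?_, ?_⟩
    · have := hl i
      by_cases h : i = j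
      · subst h; simpa using hj
      · simpa [h] using this
    · simp [Finset.sum_add_distrib, hs]

theorem mem_deepRegion_or_mem_dyadicCell {d : ℕ} (M : ℕ) {x : Fin d → ℝ} (hx : ∀ j, x j ≤ 1) :
    x ∈ deepRegion d M ∨ ∃ k ∈ dyadicIndices d M, x ∈ dyadicCell k := by
  classical
  let k : Fin d → ℕ := fun j => Nat.findGreatest (fun m => x j ≤ (1 / 2) ^ m) (M + 1)
  have hle : ∀ j, x j ≤ (1 / 2) ^ k j := fun j =>
    Nat.findGreatest_spec (P := fun m => x j ≤ (1 / 2) ^ m) (Nat.zero_le _) (by simpa using hx j)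
  by_cases h : ∑ j, k j ≤ M
  · refine Or.inr ⟨k, mem_dyadicIndices.2 h, fun j _ => ⟨?_, hle j⟩⟩
    have := Finset.single_le_sum (f := k) (fun i _ => Nat.zero_le _) (Finset.mem_univ j)
    exact not_le.1 (Nat.findGreatest_is_greatest (P := fun m => x j ≤ (1 / 2) ^ m)
      (Nat.lt_succ_self (k j)) (by omega))
  · obtain ⟨l, hl, hs⟩ := exists_le_sum_eq k (m := M + 1) (by omega)
    refine Or.inl (Set.mem_biUnion (x := l) (by simpa using hs) fun j _ => ?_)
    exact (hle j).trans (pow_le_pow_of_le_one (by norm_num) (by norm_num) (hl j))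

theorem measurableSet_dyadicCell {d : ℕ} (k : Fin d → ℕ) : MeasurableSet (dyadicCell k) :=
  MeasurableSet.univ_pi fun _ => measurableSet_Ioc

theorem measurableSet_deepRegion (d M : ℕ) : MeasurableSet (deepRegion d M) :=
  Finset.measurableSet_biUnion _ fun _ _ => MeasurableSet.univ_pi fun _ => measurableSet_Iic

theorem cubeMeasure_real_pi {d : ℕ} (s : Fin d → Set ℝ) :
    (cubeMeasure d).real (Set.univ.pi s) =
      ∏ j, (volume.restrict (Set.Icc (0 : ℝ) 1)).real (s j) := by
  simp [cubeMeasure, Measure.real, Measure.pi_pi, ENNReal.toReal_prod]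

theorem cubeMeasure_real_dyadicCell {d : ℕ} (k : Fin d → ℕ) :
    (cubeMeasure d).real (dyadicCell k) = (1 / 2) ^ (∑ j, k j + d) := by
  have h : ∀ m : ℕ, (volume.restrict (Set.Icc (0 : ℝ) 1)).real
      (Set.Ioc ((1 / 2) ^ (m + 1)) ((1 / 2) ^ m)) = (1 / 2) ^ (m + 1) := by
    intro m
    have h0 : (0 : ℝ) ≤ (1 / 2) ^ (m + 1) := by positivity
    have h1 : (1 / 2 : ℝ) ^ m ≤ 1 := pow_le_one₀ (by norm_num) (by norm_num)
    rw [measureReal_restrict_apply measurableSet_Ioc, Set.inter_eq_left.2, Real.volume_real_Ioc,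
      max_eq_left]
    · ring
    · have : (0 : ℝ) ≤ (1 / 2) ^ m := by positivity
      rw [pow_succ]; linarith
    · exact fun y hy => ⟨h0.trans hy.1.le, hy.2.trans h1⟩
  rw [dyadicCell, cubeMeasure_real_pi]
  simp only [h]
  rw [Finset.prod_pow_eq_pow_sum]
  simp [Finset.sum_add_distrib]

theorem cubeMeasure_real_dyadicCorner {d : ℕ} (k : Fin d → ℕ) :
    (cubeMeasure d).real (dyadicCorner k) = (1 / 2) ^ ∑ j, k j := by
  have h : ∀ m : ℕ, (volume.restrict (Set.Icc (0 : ℝ) 1)).real (Set.Iic ((1 / 2) ^ m))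
      = (1 / 2) ^ m := by
    intro m
    have h1 : (1 / 2 : ℝ) ^ m ≤ 1 := pow_le_one₀ (by norm_num) (by norm_num)
    have : Set.Iic ((1 / 2 : ℝ) ^ m) ∩ Set.Icc 0 1 = Set.Icc 0 ((1 / 2) ^ m) := by
      ext y
      simp only [Set.mem_inter_iff, Set.mem_Iic, Set.mem_Icc]
      exact ⟨fun hy => ⟨hy.2.1, hy.1⟩, fun hy => ⟨hy.2, hy.1, hy.2.trans h1⟩⟩
    rw [measureReal_restrict_apply measurableSet_Iic, this, Real.volume_real_Icc, sub_zero,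
      max_eq_left (by positivity)]
  rw [dyadicCorner, cubeMeasure_real_pi]
  simp only [h]
  rw [Finset.prod_pow_eq_pow_sum]

theorem cubeMeasure_real_deepRegion_le (d M : ℕ) :
    (cubeMeasure d).real (deepRegion d M) ≤ ((M : ℝ) + 2) ^ (d - 1) * (1 / 2) ^ (M + 1) := by
  refine (measureReal_biUnion_finset_le _ _).trans ?_
  rw [Finset.sum_congr rfl (g := fun _ => (1 / 2 : ℝ) ^ (M + 1))]
  · rw [Finset.sum_const, nsmul_eq_mul]
    gcongr
    have := card_piAntidiag_le d (M + 1)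
    calc _ ≤ (((M + 1 + 1) ^ (d - 1) : ℕ) : ℝ) := by exact_mod_cast this
      _ = _ := by push_cast; ring
  · intro k hk
    have hk : ∑ i, k i = M + 1 := by simpa using hk
    rw [cubeMeasure_real_dyadicCorner, hk]

theorem pairwise_disjoint_dyadicCell (d : ℕ) :
    Pairwise (Function.onFun Disjoint (dyadicCell (d := d))) := by
  intro k l hkl
  obtain ⟨j, hj⟩ := Function.ne_iff.1 hkl
  refine Set.disjoint_left.2 fun x hx hy => ?_
  have hx := hx j trivial
  have hy := hy j trivial
  have key : ∀ a b : ℕ, a < b → (1 / 2 : ℝ) ^ (a + 1) < x j → x j ≤ (1 / 2) ^ b → False := by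
    intro a b hab h1 h2
    have : (1 / 2 : ℝ) ^ b ≤ (1 / 2) ^ (a + 1) :=
      pow_le_pow_of_le_one (by norm_num) (by norm_num) hab
    linarith
  rcases lt_or_gt_of_ne hj with h | h
  · exact key _ _ h hx.1 hy.2
  · exact key _ _ h hy.1 hx.2

theorem cubeMeasure_real_biUnion_dyadicCell {d : ℕ} (S : Finset (Fin d → ℕ)) :
    (cubeMeasure d).real (⋃ k ∈ S, dyadicCell k) = ∑ k ∈ S, (1 / 2) ^ (∑ j, k j + d) := by
  rw [measureReal_biUnion_finset ((pairwise_disjoint_dyadicCell d).set_pairwise _)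
    fun k _ => measurableSet_dyadicCell k]
  simp only [cubeMeasure_real_dyadicCell]

theorem cubeMeasure_real_biUnion_dyadicCell_add_one {d : ℕ} (S : Finset (Fin d → ℕ)) :
    (cubeMeasure d).real (⋃ k ∈ S, dyadicCell (k + 1)) =
      ∑ k ∈ S, (1 / 2) ^ (∑ j, k j + 2 * d) := by
  rw [measureReal_biUnion_finset _ fun k _ => measurableSet_dyadicCell _]
  · refine Finset.sum_congr rfl fun k _ => ?_
    rw [cubeMeasure_real_dyadicCell]
    simp only [Pi.add_apply, Pi.one_apply, Finset.sum_add_distrib]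
    simp
    ring
  · intro k _ l _ hkl
    exact pairwise_disjoint_dyadicCell d fun h => hkl (add_right_cancel h)

section Weight

variable {X : Type*} {δ : ℝ} {E G D : Set X}

theorem cellWeight_nonneg (hδ : 0 ≤ δ) (x : X) : 0 ≤ cellWeight δ E G D x := by
  have h : ∀ s : Set X, 0 ≤ s.indicator (1 : X → ℝ) x ∧ s.indicator (1 : X → ℝ) x ≤ 1 := by
    intro s
    by_cases hs : x ∈ s <;> simp [hs]
  have := mul_nonneg hδ (add_nonneg (h G).1 (h D).1)
  have := (h E).2
  unfold cellWeight
  linarith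

theorem one_add_pow_ncard_le_prod_cellWeight (hδ : 0 ≤ δ) {n : ℕ} (p : Fin n → X)
    (hE : ∀ i, p i ∉ E) (t : Set (Fin n)) (ht : ∀ i ∈ t, p i ∈ D ∨ p i ∈ G) :
    (1 + δ) ^ t.ncard ≤ ∏ i, cellWeight δ E G D (p i) := by
  classical
  have h1 : (1 + δ) ^ t.ncard = ∏ i, if i ∈ t then 1 + δ else 1 := by
    rw [Finset.prod_ite]
    simp [Set.ncard_eq_toFinset_card']
  rw [h1]
  refine Finset.prod_le_prod (fun i _ => by split_ifs <;> linarith) fun i _ => ?_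
  by_cases hD : p i ∈ D <;> by_cases hG : p i ∈ G <;> by_cases hi : i ∈ t <;>
    simp [cellWeight, hE i, hD, hG, hi] <;> first | nlinarith | skip
  exact absurd (ht i hi) (by tauto)

variable [MeasurableSpace X] (μ : Measure X) [IsProbabilityMeasure μ]

theorem integrable_cellWeight (hE : MeasurableSet E) (hG : MeasurableSet G)
    (hD : MeasurableSet D) : Integrable (cellWeight δ E G D) μ :=
  ((integrable_const 1).sub ((integrable_const 1).indicator hE)).add
    ((((integrable_const 1).indicator hG).add ((integrable_const 1).indicator hD)).const_mul δ)

theorem integral_cellWeight (hE : MeasurableSet E) (hG : MeasurableSet G)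
    (hD : MeasurableSet D) :
    ∫ x, cellWeight δ E G D x ∂μ = 1 - μ.real E + δ * (μ.real G + μ.real D) := by
  have iE : Integrable (E.indicator (1 : X → ℝ)) μ := (integrable_const 1).indicator hE
  have iG : Integrable (G.indicator (1 : X → ℝ)) μ := (integrable_const 1).indicator hG
  have iD : Integrable (D.indicator (1 : X → ℝ)) μ := (integrable_const 1).indicator hD
  have i1 : Integrable (fun x => 1 - E.indicator (1 : X → ℝ) x) μ := (integrable_const 1).sub iE
  have i2 : Integrable (fun x => G.indicator (1 : X → ℝ) x + D.indicator (1 : X → ℝ) x) μ :=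
    iG.add iD
  unfold cellWeight
  rw [integral_add i1 (i2.const_mul δ), integral_sub (integrable_const 1) iE, integral_const_mul,
    integral_add iG iD, integral_indicator_one hE, integral_indicator_one hG,
    integral_indicator_one hD]
  simp

end Weight

/-- The weight attached to a set `S` of cells: it vanishes on the shifted cells and exceeds one on
the cells of `S` and on the deep region. -/
noncomputable def familyWeight (d M : ℕ) (S : Finset (Fin d → ℕ)) : (Fin d → ℝ) → ℝ :=
  cellWeight ((1 / 2) ^ (d + 1)) (⋃ k ∈ S, dyadicCell (k + 1)) (⋃ k ∈ S, dyadicCell k)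
    (deepRegion d M)

theorem integrable_familyWeight (d M : ℕ) (S : Finset (Fin d → ℕ)) :
    Integrable (familyWeight d M S) (cubeMeasure d) :=
  integrable_cellWeight _ (Finset.measurableSet_biUnion _ fun _ _ => measurableSet_dyadicCell _)
    (Finset.measurableSet_biUnion _ fun _ _ => measurableSet_dyadicCell _)
    (measurableSet_deepRegion d M)

theorem integral_familyWeight_le (d M : ℕ) (S : Finset (Fin d → ℕ)) :
    ∫ x, familyWeight d M S x ∂cubeMeasure d ≤
      Real.exp ((cubeMeasure d).real (deepRegion d M) -
        ∑ k ∈ S, (1 / 2) ^ (∑ j, k j + (2 * d + 1))) := by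
  unfold familyWeight
  rw [integral_cellWeight _ (Finset.measurableSet_biUnion _ fun _ _ => measurableSet_dyadicCell _)
    (Finset.measurableSet_biUnion _ fun _ _ => measurableSet_dyadicCell _)
    (measurableSet_deepRegion d M), cubeMeasure_real_biUnion_dyadicCell,
    cubeMeasure_real_biUnion_dyadicCell_add_one]
  refine le_trans ?_ (Real.add_one_le_exp _)
  have h1 : ∑ k ∈ S, (1 / 2 : ℝ) ^ (∑ j, k j + 2 * d) =
      2 * ∑ k ∈ S, (1 / 2) ^ (∑ j, k j + (2 * d + 1)) := by
    rw [Finset.mul_sum]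
    exact Finset.sum_congr rfl fun k _ => by ring
  have h2 : (1 / 2 : ℝ) ^ (d + 1) * ∑ k ∈ S, (1 / 2) ^ (∑ j, k j + d) =
      ∑ k ∈ S, (1 / 2) ^ (∑ j, k j + (2 * d + 1)) := by
    rw [Finset.mul_sum]
    exact Finset.sum_congr rfl fun k _ => by ring
  have h3 : (1 / 2 : ℝ) ^ (d + 1) * (cubeMeasure d).real (deepRegion d M) ≤
      (cubeMeasure d).real (deepRegion d M) :=
    mul_le_of_le_one_left measureReal_nonneg (pow_le_one₀ (by norm_num) (by norm_num))
  rw [mul_add, h1, h2]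
  linarith

theorem one_add_pow_ncard_minimalIndices_le {n d M : ℕ} (hd : 0 < d) {p : Fin n → Fin d → ℝ}
    (hp : ∀ i j, p i j ≤ 1) :
    (1 + (1 / 2 : ℝ) ^ (d + 1)) ^ (minimalIndices p).ncard ≤
      ∑ S ∈ (dyadicIndices d M).powerset, ∏ i, familyWeight d M S (p i) := by
  classical
  let S := (dyadicIndices d M).filter fun k => ∀ i, p i ∉ dyadicCell (k + 1)
  have hδ : (0 : ℝ) ≤ (1 / 2) ^ (d + 1) := by positivity
  refine le_trans ?_ (Finset.single_le_sum (f := fun S => ∏ i, familyWeight d M S (p i))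
    (fun T _ => Finset.prod_nonneg fun i _ => cellWeight_nonneg hδ _)
    (Finset.mem_powerset.2 (Finset.filter_subset _ _ : S ⊆ dyadicIndices d M)))
  refine one_add_pow_ncard_le_prod_cellWeight hδ p ?_ _ fun i hi => ?_
  · intro i hi
    obtain ⟨k, hk, hik⟩ := Set.mem_iUnion₂.1 hi
    exact (Finset.mem_filter.1 hk).2 i hik
  · refine (mem_deepRegion_or_mem_dyadicCell M (hp i)).imp_right ?_
    rintro ⟨k, hk, hik⟩
    refine Set.mem_biUnion (Finset.mem_coe.2 (Finset.mem_filter.2 ⟨hk, fun j hj => ?_⟩)) hik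
    have hlt : ∀ l, 0 < p j l ∧ p j l < p i l := fun l =>
      ⟨lt_trans (by positivity) (hj l trivial).1, (hj l trivial).2.trans_lt (hik l trivial).1⟩
    refine hi j ?_ hlt
    rintro rfl
    exact lt_irrefl _ (hlt ⟨0, hd⟩).2

theorem integral_sum_prod_familyWeight_le (n d M : ℕ) :
    ∫ p, ∑ S ∈ (dyadicIndices d M).powerset, ∏ i, familyWeight d M S (p i) ∂unifCube n d ≤
      Real.exp (n * (cubeMeasure d).real (deepRegion d M) +
        ∑ k ∈ dyadicIndices d M, Real.exp (-(n * (1 / 2) ^ (∑ j, k j + (2 * d + 1))))) := by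
  have hδ : (0 : ℝ) ≤ (1 / 2) ^ (d + 1) := by positivity
  rw [unifCube_eq_pi, integral_finsetSum _ fun S _ =>
    Integrable.fintype_prod fun _ => integrable_familyWeight d M S]
  calc _ ≤ ∑ S ∈ (dyadicIndices d M).powerset,
        Real.exp (n * (cubeMeasure d).real (deepRegion d M)) *
          ∏ k ∈ S, Real.exp (-(n * (1 / 2) ^ (∑ j, k j + (2 * d + 1)))) := by
        refine Finset.sum_le_sum fun S _ => ?_
        rw [integral_fintype_prod_eq_pow, Fintype.card_fin]
        refine (pow_le_pow_left₀ (integral_nonneg fun x => cellWeight_nonneg hδ x)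
          (integral_familyWeight_le d M S) n).trans_eq ?_
        rw [← Real.exp_nat_mul, ← Real.exp_sum, ← Real.exp_add, Finset.sum_neg_distrib,
          ← Finset.mul_sum, mul_sub, sub_eq_add_neg]
    _ = Real.exp (n * (cubeMeasure d).real (deepRegion d M)) * ∏ k ∈ dyadicIndices d M,
          (1 + Real.exp (-(n * (1 / 2) ^ (∑ j, k j + (2 * d + 1))))) := by
        rw [← Finset.mul_sum, Finset.prod_one_add]
    _ ≤ _ := by
        rw [Real.exp_add, Real.exp_sum]
        gcongr with k _
        rw [add_comm]
        exact Real.add_one_le_exp _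

theorem sum_dyadicIndices_exp_le {n : ℝ} {d M : ℕ} (hn : 2 ^ M ≤ n) :
    ∑ k ∈ dyadicIndices d M, Real.exp (-(n * (1 / 2) ^ (∑ j, k j + (2 * d + 1)))) ≤
      2 ^ (2 * d + 2) * ((M : ℝ) + 2) ^ (d - 1) := by
  have hn0 : 0 < n := lt_of_lt_of_le (by positivity) hn
  have hexp : ∀ m : ℕ, Real.exp (-(n * (1 / 2) ^ m)) ≤ 2 ^ m / n := by
    intro m
    have hy : 0 < n * (1 / 2 : ℝ) ^ m := by positivity
    rw [Real.exp_neg]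
    calc _ ≤ (n * (1 / 2 : ℝ) ^ m)⁻¹ := by
          gcongr
          linarith [Real.add_one_le_exp (n * (1 / 2 : ℝ) ^ m)]
      _ = _ := by rw [mul_inv, ← inv_pow]; norm_num; ring
  have hgeom : ∑ m ∈ Finset.range (M + 1), (2 : ℝ) ^ m ≤ 2 * n := by
    rw [geom_sum_eq (by norm_num)]
    rw [pow_succ]
    linarith
  rw [dyadicIndices, Finset.sum_biUnion]
  · calc _ ≤ ∑ m ∈ Finset.range (M + 1), ((M : ℝ) + 2) ^ (d - 1) *
          (2 ^ (m + (2 * d + 1)) / n) := by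
          refine Finset.sum_le_sum fun m hm => ?_
          have hm : m ≤ M := by simpa [Nat.lt_succ_iff] using hm
          calc _ ≤ ∑ k ∈ (Finset.univ.piAntidiag m : Finset (Fin d → ℕ)),
                (2 ^ (m + (2 * d + 1)) / n : ℝ) := by
                refine Finset.sum_le_sum fun k hk => ?_
                have hk : ∑ i, k i = m := by simpa using hk
                rw [hk]
                exact hexp _
            _ ≤ _ := by
                rw [Finset.sum_const, nsmul_eq_mul]
                gcongr
                calc _ ≤ (((m + 1) ^ (d - 1) : ℕ) : ℝ) := by
                      exact_mod_cast card_piAntidiag_le d m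
                  _ ≤ _ := by
                      push_cast
                      have : (m : ℝ) ≤ M := by exact_mod_cast hm
                      gcongr
                      linarith
      _ = ((M : ℝ) + 2) ^ (d - 1) * 2 ^ (2 * d + 1) / n * ∑ m ∈ Finset.range (M + 1), 2 ^ m := by
          rw [Finset.mul_sum]
          exact Finset.sum_congr rfl fun m _ => by ring
      _ ≤ ((M : ℝ) + 2) ^ (d - 1) * 2 ^ (2 * d + 1) / n * (2 * n) := by gcongr
      _ = _ := by field_simp; ring
  · intro a _ b _ hab
    refine Finset.disjoint_left.2 fun k hk hk' => hab ?_
    have h1 : ∑ i, k i = a := by simpa using hk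
    have h2 : ∑ i, k i = b := by simpa using hk'
    omega

/-- Exponential tail bound for the number of minimal points. -/
theorem unifCube_real_lt_ncard_minimalIndices_le {n d M : ℕ} (hd : 0 < d) (hM : 2 ^ M ≤ n)
    (hM' : n < 2 ^ (M + 1)) (t : ℝ) :
    (unifCube n d).real {p | t < ((minimalIndices p).ncard : ℝ)} ≤
      Real.exp ((2 ^ (2 * d + 2) + 1) * ((M : ℝ) + 2) ^ (d - 1) -
        t * Real.log (1 + (1 / 2) ^ (d + 1))) := by
  have hδ : (0 : ℝ) < (1 / 2) ^ (d + 1) := by positivity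
  set a : ℝ := 1 + (1 / 2) ^ (d + 1) with ha
  have ha1 : 1 < a := by linarith
  let f : (Fin n → Fin d → ℝ) → ℝ := fun p =>
    ∑ S ∈ (dyadicIndices d M).powerset, ∏ i, familyWeight d M S (p i)
  have hf0 : ∀ p, 0 ≤ f p := fun p => Finset.sum_nonneg fun S _ =>
    Finset.prod_nonneg fun i _ => cellWeight_nonneg hδ.le _
  have hfi : Integrable f (unifCube n d) := integrable_finsetSum _ fun S _ =>
    Integrable.fintype_prod fun _ => integrable_familyWeight d M S
  have hmarkov := mul_meas_ge_le_integral_of_nonneg (ae_of_all _ hf0) hfi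
    (Real.exp (t * Real.log a))
  have hsub : (unifCube n d).real {p | t < ((minimalIndices p).ncard : ℝ)} ≤
      (unifCube n d).real {p | Real.exp (t * Real.log a) ≤ f p} := by
    refine ENNReal.toReal_mono (measure_ne_top _ _) (measure_mono_ae ?_)
    filter_upwards [ae_mem_cube n d] with p hp ht
    refine le_trans ?_ (one_add_pow_ncard_minimalIndices_le hd fun i j => (hp i j).2)
    rw [← ha, ← Real.rpow_natCast, Real.rpow_def_of_pos (by linarith), Real.exp_le_exp,
      mul_comm (Real.log a)]
    exact mul_le_mul_of_nonneg_right (le_of_lt ht) (Real.log_nonneg ha1.le)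
  have hint : ∫ p, f p ∂unifCube n d ≤
      Real.exp ((2 ^ (2 * d + 2) + 1) * ((M : ℝ) + 2) ^ (d - 1)) := by
    refine (integral_sum_prod_familyWeight_le n d M).trans (Real.exp_le_exp.2 ?_)
    have h1 := sum_dyadicIndices_exp_le (n := n) (d := d) (M := M) (by exact_mod_cast hM)
    have hn : (n : ℝ) ≤ 2 ^ (M + 1) := by exact_mod_cast hM'.le
    have h2 : (n : ℝ) * (cubeMeasure d).real (deepRegion d M) ≤ ((M : ℝ) + 2) ^ (d - 1) := by
      calc _ ≤ (2 : ℝ) ^ (M + 1) * (((M : ℝ) + 2) ^ (d - 1) * (1 / 2) ^ (M + 1)) :=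
            mul_le_mul hn (cubeMeasure_real_deepRegion_le d M) measureReal_nonneg (by positivity)
        _ = ((M : ℝ) + 2) ^ (d - 1) * (2 * (1 / 2)) ^ (M + 1) := by rw [mul_pow]; ring
        _ = _ := by norm_num
    linarith
  rw [Real.exp_sub, le_div_iff₀ (Real.exp_pos _), mul_comm]
  exact (mul_le_mul_of_nonneg_left hsub (Real.exp_pos _).le).trans (hmarkov.trans hint)

theorem natLog_two_add_two_le {n : ℕ} (hn : 2 ≤ n) :
    ((Nat.log 2 n : ℕ) : ℝ) + 2 ≤ 6 * Real.log n := by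
  have h2 := Real.log_two_gt_d9
  have h3 : Real.log 2 ≤ Real.log n := Real.log_le_log (by norm_num) (by exact_mod_cast hn)
  have h4 : (Nat.log 2 n : ℝ) * Real.log 2 ≤ Real.log n := by
    rw [← Real.log_pow]
    refine Real.log_le_log (by positivity) ?_
    exact_mod_cast Nat.pow_log_le_self 2 (by omega)
  have h5 : (0 : ℝ) ≤ Nat.log 2 n := by positivity
  nlinarith

theorem exists_unifCube_real_le (d : ℕ) (hd : 2 ≤ d) :
    ∃ C : ℝ, 0 < C ∧ ∀ n : ℕ, 3 ≤ n →
      (unifCube n d).real {p | C * Real.log n ^ (d - 1) < ((minimalIndices p).ncard : ℝ)} ≤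
        (n : ℝ) ^ (-2 : ℝ) := by
  have hδ : (0 : ℝ) < (1 / 2) ^ (d + 1) := by positivity
  have hlog : 0 < Real.log (1 + (1 / 2) ^ (d + 1)) := Real.log_pos (by linarith)
  refine ⟨((2 ^ (2 * d + 2) + 1) * 6 ^ (d - 1) + 2) / Real.log (1 + (1 / 2) ^ (d + 1)),
    by positivity, fun n hn => ?_⟩
  refine (unifCube_real_lt_ncard_minimalIndices_le (by omega) (Nat.pow_log_le_self 2 (by omega))
    (Nat.lt_pow_succ_log_self (by norm_num) n) _).trans ?_
  have hn0 : (0 : ℝ) < n := by exact_mod_cast (by omega : 0 < n)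
  rw [Real.rpow_def_of_pos hn0, Real.exp_le_exp]
  have hl1 : 1 ≤ Real.log n := by
    rw [Real.le_log_iff_exp_le hn0]
    have : (3 : ℝ) ≤ n := by exact_mod_cast hn
    linarith [Real.exp_one_lt_d9]
  have hpow : Real.log n ≤ Real.log n ^ (d - 1) := le_self_pow₀ hl1 (by omega)
  have h6 : ((Nat.log 2 n : ℝ) + 2) ^ (d - 1) ≤ 6 ^ (d - 1) * Real.log n ^ (d - 1) := by
    rw [← mul_pow]
    exact pow_le_pow_left₀ (by positivity) (natLog_two_add_two_le (by omega)) _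
  have h7 := mul_le_mul_of_nonneg_left h6 (by positivity : (0 : ℝ) ≤ 2 ^ (2 * d + 2) + 1)
  rw [mul_right_comm, div_mul_cancel₀ _ hlog.ne']
  linarith

theorem stmt_19 (d : ℕ) (hd : 2 ≤ d) :
    ∃ C : ℝ, 0 < C ∧
      Tendsto (fun n : ℕ =>
        ((n : ENNReal) ^ ((3 : ℝ) / 2)) *
          unifCube n d {p : Fin n → Fin d → ℝ |
            C * Real.log n ^ (d - 1) <
              -- N: the number of indices i such that no other point lies in R[0, pᵢ]
              (({i : Fin n | ∀ j : Fin n, j ≠ i →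
                  ¬ (∀ k, 0 < p j k ∧ p j k < p i k)}).ncard : ℝ)})
        atTop (nhds 0) := by
  obtain ⟨C, hC, h⟩ := exists_unifCube_real_le d hd
  refine ⟨C, hC, ?_⟩
  have hlim : Tendsto (fun n : ℕ => ENNReal.ofReal ((n : ℝ) ^ (-(1 / 2) : ℝ))) atTop (nhds 0) := by
    rw [← ENNReal.ofReal_zero]
    exact (ENNReal.continuous_ofReal.tendsto 0).comp
      ((tendsto_rpow_neg_atTop (by norm_num)).comp tendsto_natCast_atTop_atTop)
  refine tendsto_of_tendsto_of_tendsto_of_le_of_le' tendsto_const_nhds hlim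
    (Eventually.of_forall fun _ => zero_le) ?_
  filter_upwards [eventually_ge_atTop 3] with n hn
  have hn0 : (0 : ℝ) < n := by exact_mod_cast (by omega : 0 < n)
  have hcast : (n : ENNReal) ^ ((3 : ℝ) / 2) = ENNReal.ofReal ((n : ℝ) ^ ((3 : ℝ) / 2)) := by
    rw [← ENNReal.ofReal_rpow_of_pos hn0, ENNReal.ofReal_natCast]
  have hbound := h n hn
  rw [Measure.real, ← ENNReal.le_ofReal_iff_toReal_le (measure_ne_top _ _) (by positivity)]
    at hbound
  calc _ ≤ ENNReal.ofReal ((n : ℝ) ^ ((3 : ℝ) / 2)) * ENNReal.ofReal ((n : ℝ) ^ (-2 : ℝ)) := by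
        rw [hcast]
        exact mul_le_mul_right hbound _
    _ = _ := by
        rw [← ENNReal.ofReal_mul (by positivity), ← Real.rpow_add hn0]
        norm_num
end
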